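/- arXiv:1708.06633 — 5 statements merged into one kernel-verified Lean document; each statement's English description precedes it below -/
import Mathlib

section
/- Wavelet coefficients of generalized additive Hölder functions (Lemma on wavelet decay). Let q be a positive integer and let ψ : ℝ → ℝ be a bounded measurable function, not almost everywhere zero, whose support is contained in [0,2^q]. For j ∈ ℕ and k ∈ ℤ set ψ_{j,k}(x) := 2^{j/2}·ψ(2^j x − k), and set ν := ⌈log₂ d⌉ + 1. Then for any 0 < α ≤ 1 and any K > 0 there exists a nonzero constant c(ψ,d), depending only on d and ψ, such that for every integer j ≥ q + ν there is a function f_{j,α}(x₁,…,x_d) = h_{j,α}(x₁ + … + x_d) with h_{j,α} ∈ C_1^α([0,d],K) satisfying ∫_{[0,1]^d} f_{j,α}(x)·∏_{r=1}^d ψ_{j, 2^{q+ν} p_r}(x_r) dx = c(ψ,d)·K·2^{−(j/2)(2α+d)} for all p₁,…,p_d ∈ {0,1,…,2^{j−q−ν}−1}. -/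
open MeasureTheory ProbabilityTheory

noncomputable section

/-! ## ReLU networks -/

/-- The ReLU activation function. -/
def relu (x : ℝ) : ℝ := max x 0

/-- Componentwise shifted ReLU activation `σ_v`. -/
def shiftAct {k : ℕ} (v y : Fin k → ℝ) : Fin k → ℝ := fun j => relu (y j - v j)

/-- Value after applying `W_k σ_{v_k} ⋯ σ_{v_1} W_0` to the input `x`. -/
def netLayers (p : ℕ → ℕ) (W : ∀ i, Matrix (Fin (p (i + 1))) (Fin (p i)) ℝ)
    (v : ∀ i, Fin (p i) → ℝ) (x : Fin (p 0) → ℝ) : (k : ℕ) → Fin (p (k + 1)) → ℝ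
  | 0 => (W 0).mulVec x
  | k + 1 => (W (k + 1)).mulVec (shiftAct (v (k + 1)) (netLayers p W v x k))

/-- The function `x ↦ W_L σ_{v_L} W_{L-1} ⋯ W_1 σ_{v_1} W_0 x` computed by a
network with `L` hidden layers and width vector `p 0, …, p (L+1)`. -/
def networkFun (L : ℕ) (p : ℕ → ℕ) (W : ∀ i, Matrix (Fin (p (i + 1))) (Fin (p i)) ℝ)
    (v : ∀ i, Fin (p i) → ℝ) : (Fin (p 0) → ℝ) → Fin (p (L + 1)) → ℝ :=
  fun x => netLayers p W v x L

/-- Number of nonzero entries of a matrix. -/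
def matSupp {a b : ℕ} (W : Matrix (Fin a) (Fin b) ℝ) : ℕ :=
  {ij : Fin a × Fin b | W ij.1 ij.2 ≠ 0}.ncard

/-- Number of nonzero entries of a vector. -/
def vecSupp {a : ℕ} (v : Fin a → ℝ) : ℕ := {j : Fin a | v j ≠ 0}.ncard

/-- Total number of nonzero network parameters. -/
def totalSparsity (L : ℕ) (p : ℕ → ℕ) (W : ∀ i, Matrix (Fin (p (i + 1))) (Fin (p i)) ℝ)
    (v : ∀ i, Fin (p i) → ℝ) : ℕ :=
  (∑ i ∈ Finset.range (L + 1), matSupp (W i)) + ∑ i ∈ Finset.Icc 1 L, vecSupp (v i)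

/-- `F(L,p)`: network functions with all parameters bounded in absolute value by one. -/
def NetClass (L : ℕ) (p : ℕ → ℕ) : Set ((Fin (p 0) → ℝ) → Fin (p (L + 1)) → ℝ) :=
  {f | ∃ (W : ∀ i, Matrix (Fin (p (i + 1))) (Fin (p i)) ℝ) (v : ∀ i, Fin (p i) → ℝ),
    (∀ i j k, |W i j k| ≤ 1) ∧ (∀ i j, |v i j| ≤ 1) ∧ f = networkFun L p W v}

/-- `F(L,p,s)`: networks with at most `s` nonzero parameters. -/
def SparseNetClass (L : ℕ) (p : ℕ → ℕ) (s : ℕ) :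
    Set ((Fin (p 0) → ℝ) → Fin (p (L + 1)) → ℝ) :=
  {f | ∃ (W : ∀ i, Matrix (Fin (p (i + 1))) (Fin (p i)) ℝ) (v : ∀ i, Fin (p i) → ℝ),
    (∀ i j k, |W i j k| ≤ 1) ∧ (∀ i j, |v i j| ≤ 1) ∧
    totalSparsity L p W v ≤ s ∧ f = networkFun L p W v}

/-- The unit hypercube `[0,1]^r`. -/
def unitCube (r : ℕ) : Set (Fin r → ℝ) := {x | ∀ i, x i ∈ Set.Icc (0 : ℝ) 1}

/-- `F(L,p,s,F)`: sparse networks uniformly bounded by `F` on the unit cube. -/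
def SparseNetClassB (L : ℕ) (p : ℕ → ℕ) (s : ℕ) (F : ℝ) :
    Set ((Fin (p 0) → ℝ) → Fin (p (L + 1)) → ℝ) :=
  {f | f ∈ SparseNetClass L p s ∧ ∀ x ∈ unitCube (p 0), ∀ j, |f x j| ≤ F}

/-- Scalar-valued version of `F(L,p)` for input dimension `din`; membership
forces `p 0 = din`, and is meaningful for `p (L+1) = 1`. -/
def ScalarNetClassD (din L : ℕ) (p : ℕ → ℕ) : Set ((Fin din → ℝ) → ℝ) :=
  {f | ∃ h0 : p 0 = din, ∃ g ∈ NetClass L p,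
    ∀ (x : Fin din → ℝ) (j : Fin (p (L + 1))), f x = g (fun k => x (Fin.cast h0 k)) j}

/-- Scalar-valued version of `F(L,p,s)`. -/
def ScalarSparseNetClassD (din L : ℕ) (p : ℕ → ℕ) (s : ℕ) : Set ((Fin din → ℝ) → ℝ) :=
  {f | ∃ h0 : p 0 = din, ∃ g ∈ SparseNetClass L p s,
    ∀ (x : Fin din → ℝ) (j : Fin (p (L + 1))), f x = g (fun k => x (Fin.cast h0 k)) j}

/-- Scalar-valued version of `F(L,p,s,F)`. -/
def ScalarSparseNetClassBD (din L : ℕ) (p : ℕ → ℕ) (s : ℕ) (F : ℝ) :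
    Set ((Fin din → ℝ) → ℝ) :=
  {f | ∃ h0 : p 0 = din, ∃ g ∈ SparseNetClassB L p s F,
    ∀ (x : Fin din → ℝ) (j : Fin (p (L + 1))), f x = g (fun k => x (Fin.cast h0 k)) j}

/-! ## Hölder balls -/

/-- The largest integer strictly smaller than `β` (for `β > 0`). -/
def strictFloor (β : ℝ) : ℕ := (⌈β⌉ - 1).toNat

/-- Partial derivative in direction `i`. -/
def partialDeriv {r : ℕ} (i : Fin r) (f : (Fin r → ℝ) → ℝ) : (Fin r → ℝ) → ℝ :=
  fun x => fderiv ℝ f x (Pi.single i 1)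

def multiPartialList {r : ℕ} : List (Fin r) → ((Fin r → ℝ) → ℝ) → (Fin r → ℝ) → ℝ
  | [], f => f
  | i :: l, f => partialDeriv i (multiPartialList l f)

/-- Mixed partial derivative `∂^α f` for a multi-index `α`. -/
def multiPartial {r : ℕ} (α : Fin r → ℕ) (f : (Fin r → ℝ) → ℝ) : (Fin r → ℝ) → ℝ :=
  multiPartialList ((List.finRange r).flatMap fun i => List.replicate (α i) i) f

/-- Multi-indices `α` with `|α| < β`. -/
def multiIndicesLt (r : ℕ) (β : ℝ) : Finset (Fin r → ℕ) :=
  (Fintype.piFinset fun _ : Fin r => Finset.range (strictFloor β + 1)).filter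
    fun α => ((∑ i, α i : ℕ) : ℝ) < β

/-- Multi-indices `α` with `|α| = ⌊β⌋` (largest integer `< β`). -/
def multiIndicesEq (r : ℕ) (β : ℝ) : Finset (Fin r → ℕ) :=
  (Fintype.piFinset fun _ : Fin r => Finset.range (strictFloor β + 1)).filter
    fun α => ∑ i, α i = strictFloor β

/-- The Hölder norm appearing in the definition of the ball `C_r^β(D,K)`. -/
def holderNorm (r : ℕ) (β : ℝ) (D : Set (Fin r → ℝ)) (f : (Fin r → ℝ) → ℝ) : ℝ :=
  (∑ α ∈ multiIndicesLt r β, ⨆ x ∈ D, |multiPartial α f x|) +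
  ∑ α ∈ multiIndicesEq r β, ⨆ x ∈ D, ⨆ y ∈ D,
    |multiPartial α f x - multiPartial α f y| / ‖x - y‖ ^ (β - (strictFloor β : ℝ))

/-- The Hölder ball `C_r^β(D,K)`. -/
def HolderBall (r : ℕ) (β K : ℝ) (D : Set (Fin r → ℝ)) : Set ((Fin r → ℝ) → ℝ) :=
  {f | (∀ α : Fin r → ℕ, ∑ i, α i < strictFloor β →
          ∀ x ∈ D, DifferentiableAt ℝ (multiPartial α f) x) ∧
    holderNorm r β D f ≤ K}

/-- Univariate Hölder ball `C_1^α([A,B],K)` for `0 < α ≤ 1`. -/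
def holderBall1 (α K A B : ℝ) : Set (ℝ → ℝ) :=
  {h | (⨆ x ∈ Set.Icc A B, |h x|) +
      (⨆ x ∈ Set.Icc A B, ⨆ y ∈ Set.Icc A B, |h x - h y| / |x - y| ^ α) ≤ K}

/-! ## Composition classes -/

/-- The hypercube `[a,b]^r`. -/
def cube (r : ℕ) (a b : ℝ) : Set (Fin r → ℝ) := {x | ∀ i, x i ∈ Set.Icc a b}

/-- The composition `g_{k-1} ∘ ⋯ ∘ g_0`. -/
def compChain (d : ℕ → ℕ) (g : ∀ i, (Fin (d i) → ℝ) → Fin (d (i + 1)) → ℝ) :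
    (k : ℕ) → (Fin (d 0) → ℝ) → Fin (d k) → ℝ
  | 0 => fun x => x
  | k + 1 => fun x => g k (compChain d g k x)

/-- The composition class `G(q, d, t, β, K)` (with `d 0`-dimensional input on
`[0,1]^{d 0}` and real values, meaningful when `d (q+1) = 1`). -/
def CompositionClass (q : ℕ) (d t : ℕ → ℕ) (β : ℕ → ℝ) (K : ℝ) :
    Set ((Fin (d 0) → ℝ) → ℝ) :=
  {f | ∃ (a b : ℕ → ℝ) (g : ∀ i, (Fin (d i) → ℝ) → Fin (d (i + 1)) → ℝ),
    a 0 = 0 ∧ b 0 = 1 ∧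
    (∀ i ≤ q + 1, |a i| ≤ K ∧ |b i| ≤ K) ∧
    (∀ i ≤ q, ∀ x ∈ cube (d i) (a i) (b i), g i x ∈ cube (d (i + 1)) (a (i + 1)) (b (i + 1))) ∧
    (∀ i ≤ q, ∀ j : Fin (d (i + 1)), ∃ (idx : Fin (t i) → Fin (d i))
        (h : (Fin (t i) → ℝ) → ℝ),
        h ∈ HolderBall (t i) (β i) K (cube (t i) (a i) (b i)) ∧
        ∀ x ∈ cube (d i) (a i) (b i), g i x j = h fun k => x (idx k)) ∧
    ∀ x ∈ cube (d 0) 0 1, ∀ j, f x = compChain d g (q + 1) x j}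

/-! ## Rates -/

/-- Effective smoothness index `β_i^* = β_i ∏_{ℓ=i+1}^q (β_ℓ ∧ 1)`. -/
def betaStar (q : ℕ) (β : ℕ → ℝ) (i : ℕ) : ℝ :=
  β i * ∏ ℓ ∈ Finset.Icc (i + 1) q, min (β ℓ) 1

/-- The rate `φ_n = max_i n^{-2β_i^*/(2β_i^* + t_i)}`. -/
def phiRate (q : ℕ) (t : ℕ → ℕ) (β : ℕ → ℝ) (n : ℕ) : ℝ :=
  (Finset.range (q + 1)).sup' (Finset.nonempty_range_iff.mpr (Nat.succ_ne_zero q))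
    fun i => (n : ℝ) ^ (-(2 * betaStar q β i) / (2 * betaStar q β i + (t i : ℝ)))

/-! ## The nonparametric regression model -/

/-- Sample space carrying the design points `X_1,…,X_n`, the noise `ε_1,…,ε_n`
and an independent copy `X` of the design used to evaluate the prediction risk. -/
abbrev RegOmega (n d : ℕ) : Type :=
  (Fin n → (Fin d → ℝ)) × (Fin n → ℝ) × (Fin d → ℝ)

/-- Law of the data: `X_i` i.i.d. `μX`, `ε_i` i.i.d. `N(0,1)`, `X ∼ μX`, all independent. -/
def regP (n d : ℕ) (μX : Measure (Fin d → ℝ)) : Measure (RegOmega n d) :=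
  (Measure.pi fun _ : Fin n => μX).prod
    ((Measure.pi fun _ : Fin n => gaussianReal 0 1).prod μX)

/-- The observed sample `(X_i, Y_i)_{i=1,…,n}` with `Y_i = f0(X_i) + ε_i`. -/
def sampleOf {n d : ℕ} (f0 : (Fin d → ℝ) → ℝ) (ω : RegOmega n d) :
    Fin n → (Fin d → ℝ) × ℝ :=
  fun i => (ω.1 i, f0 (ω.1 i) + ω.2.1 i)

/-- The prediction error `R(f̂, f0) = E[(f̂(X) - f0(X))²]`. -/
def predRisk (n d : ℕ) (μX : Measure (Fin d → ℝ)) (f0 : (Fin d → ℝ) → ℝ)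
    (fhat : (Fin n → (Fin d → ℝ) × ℝ) → (Fin d → ℝ) → ℝ) : ℝ :=
  ∫ ω, (fhat (sampleOf f0 ω) ω.2.2 - f0 ω.2.2) ^ 2 ∂(regP n d μX)

/-- Empirical risk `n⁻¹ ∑_i (Y_i - f(X_i))²` of a fixed function `f`. -/
def empRisk {n d : ℕ} (ω : RegOmega n d) (f0 f : (Fin d → ℝ) → ℝ) : ℝ :=
  (1 / (n : ℝ)) * ∑ i : Fin n, (f0 (ω.1 i) + ω.2.1 i - f (ω.1 i)) ^ 2

/-- `Δ_n(f̂,f0)`: expected gap between the empirical risk of `f̂` and the minimal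
empirical risk over the class `C`. -/
def deltaN (n d : ℕ) (μX : Measure (Fin d → ℝ)) (f0 : (Fin d → ℝ) → ℝ)
    (fhat : (Fin n → (Fin d → ℝ) × ℝ) → (Fin d → ℝ) → ℝ)
    (C : Set ((Fin d → ℝ) → ℝ)) : ℝ :=
  ∫ ω, (empRisk ω f0 (fhat (sampleOf f0 ω)) - ⨅ f ∈ C, empRisk ω f0 f) ∂(regP n d μX)


/-- A bounded measurable function on `(0, T]` that is not almost everywhere zero has a nonzero
Fourier coefficient. -/
theorem exists_integral_fourier_mul_ne_zero {T : ℝ} [hT : Fact (0 < T)] {f : ℝ → ℂ}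
    (hfm : Measurable f) {M : ℝ} (hfb : ∀ x, ‖f x‖ ≤ M)
    (hfne : ¬ f =ᵐ[volume.restrict (Set.Ioc 0 T)] 0) :
    ∃ n : ℤ, ∫ x in Set.Ioc 0 T, fourier n (x : AddCircle T) * f x ≠ 0 := by
  by_contra! hzero
  set F : AddCircle T → ℂ := AddCircle.liftIoc T 0 f
  have hFf : ∀ x ∈ Set.Ioc 0 T, F x = f x := fun x hx =>
    AddCircle.liftIoc_coe_apply (by simpa using hx)
  have hFm : Measurable F := (hfm.comp measurable_subtype_coe).comp
    (AddCircle.measurableEquivIoc T 0).measurable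
  have hL2 : MemLp F 2 (AddCircle.haarAddCircle (T := T)) :=
    MemLp.of_bound hFm.aestronglyMeasurable M (Filter.Eventually.of_forall fun x => hfb _)
  have hcoeff : ∀ n, fourierCoeff (hL2.toLp F) n = 0 := by
    intro n
    have h1 : fourierCoeff (hL2.toLp F) n = fourierCoeff F n := by
      refine integral_congr_ae ?_
      filter_upwards [hL2.coeFn_toLp] with x hx
      rw [hx]
    have h2 : ∫ x in Set.Ioc 0 T, fourier (-n) (x : AddCircle T) • F x =
        ∫ x in Set.Ioc 0 T, fourier (-n) (x : AddCircle T) * f x :=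
      setIntegral_congr_fun measurableSet_Ioc fun x hx => by
        simp only [hFf x hx, smul_eq_mul]
    rw [h1, fourierCoeff_eq_intervalIntegral F n 0, zero_add,
      intervalIntegral.integral_of_le hT.out.le, h2, hzero, smul_zero]
  have hLp : hL2.toLp F = 0 := by
    have h := hasSum_fourier_series_L2 (hL2.toLp F)
    simp only [hcoeff, zero_smul] at h
    exact h.unique hasSum_zero
  have hF0 : F =ᵐ[(volume : Measure (AddCircle T))] 0 := by
    rw [AddCircle.volume_eq_smul_haarAddCircle]
    refine Measure.ae_smul_measure ?_ _
    exact hL2.coeFn_toLp.symm.trans (Lp.eq_zero_iff_ae_eq_zero.1 hLp)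
  refine hfne ?_
  have hpull := (AddCircle.measurePreserving_mk T 0).quasiMeasurePreserving.ae hF0
  rw [zero_add] at hpull
  filter_upwards [hpull, ae_restrict_mem measurableSet_Ioc] with x hx hmem
  exact (hFf x hmem).symm.trans hx

/-- The unit-modulus exponential with real frequency `ω` is `|ω|`-Lipschitz. -/
theorem norm_exp_I_mul_sub_exp_I_mul_le (ω x y : ℝ) :
    ‖Complex.exp (Complex.I * (ω * x : ℝ)) - Complex.exp (Complex.I * (ω * y : ℝ))‖ ≤
      |ω| * |x - y| := by
  have h : Complex.exp (Complex.I * (ω * x : ℝ)) - Complex.exp (Complex.I * (ω * y : ℝ)) =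
      Complex.exp (Complex.I * (ω * y : ℝ)) *
        (Complex.exp (Complex.I * (ω * (x - y) : ℝ)) - 1) := by
    rw [mul_sub, ← Complex.exp_add, mul_one]
    congr 2
    push_cast
    ring
  rw [h, norm_mul, mul_comm Complex.I, Complex.norm_exp_ofReal_mul_I, one_mul, ← abs_mul]
  exact Real.norm_exp_I_mul_ofReal_sub_one_le

/-- A bounded measurable function supported in one period has a nonzero multivariate ridge
coefficient against some bounded Lipschitz periodic profile. -/
theorem exists_periodic_lipschitz_integral_ne_zero (d : ℕ) {T : ℝ} (hT : 0 < T) {ψ : ℝ → ℝ}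
    (hψm : Measurable ψ) {M : ℝ} (hψb : ∀ x, |ψ x| ≤ M)
    (hψne : ¬ ψ =ᵐ[(volume : Measure ℝ)] 0)
    (hψsupp : ∀ x ∉ Set.Icc (0 : ℝ) T, ψ x = 0) :
    ∃ (g : ℝ → ℝ) (L : ℝ), Function.Periodic g T ∧ (∀ x, |g x| ≤ 1) ∧
      (∀ x y, |g x - g y| ≤ L * |x - y|) ∧
      ∫ u : Fin d → ℝ, g (∑ r, u r) * ∏ r, ψ (u r) ≠ 0 := by
  have : Fact (0 < T) := ⟨hT⟩
  have hsupp : ∀ᵐ x : ℝ, x ∉ Set.Ioc 0 T → ψ x = 0 := by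
    filter_upwards [Measure.ae_ne volume (0 : ℝ)] with x hx0 hx
    refine hψsupp x fun h => hx ⟨lt_of_le_of_ne h.1 (Ne.symm hx0), h.2⟩
  obtain ⟨n, hn⟩ := exists_integral_fourier_mul_ne_zero (T := T) (f := fun x => (ψ x : ℂ))
    (Complex.measurable_ofReal.comp hψm) (M := M) (by simpa using hψb) (by
      intro h
      refine hψne ?_
      rw [Filter.EventuallyEq, ae_restrict_iff' measurableSet_Ioc] at h
      filter_upwards [h, hsupp] with x h1 h2
      by_cases hx : x ∈ Set.Ioc 0 T
      · simpa using h1 hx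
      · exact h2 hx)
  set ω : ℝ := 2 * Real.pi * n / T with hω
  set e : ℝ → ℂ := fun x => Complex.exp (Complex.I * (ω * x : ℝ)) with he
  have he_fourier : ∀ x : ℝ, fourier n (x : AddCircle T) = e x := by
    intro x
    rw [fourier_coe_apply, he, hω]
    congr 1
    push_cast
    ring
  have hper : Function.Periodic e T := by
    intro x
    rw [← he_fourier, ← he_fourier, AddCircle.coe_add_period]
  have hnorm : ∀ x, ‖e x‖ = 1 := fun x => by
    simp only [he]
    rw [mul_comm Complex.I, Complex.norm_exp_ofReal_mul_I]
  have hlip : ∀ x y, ‖e x - e y‖ ≤ |ω| * |x - y| := norm_exp_I_mul_sub_exp_I_mul_le ω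
  have hecont : Continuous e := by fun_prop
  have hint1 : Integrable (fun x => e x * (ψ x : ℂ)) := by
    refine (integrableOn_iff_integrable_of_support_subset (s := Set.Icc 0 T) fun x hx => ?_).1 ?_
    · by_contra h
      exact hx (by simp [hψsupp x h])
    · refine IntegrableOn.of_bound (by simp) ?_ M (Filter.Eventually.of_forall fun x => ?_)
      · exact (hecont.measurable.mul
          (Complex.measurable_ofReal.comp hψm)).aestronglyMeasurable
      · simpa [hnorm] using hψb x
  have hne1 : ∫ x, e x * (ψ x : ℂ) ≠ 0 := by
    rw [← setIntegral_eq_integral_of_ae_compl_eq_zero (s := Set.Ioc 0 T)]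
    · simpa only [he_fourier] using hn
    · filter_upwards [hsupp] with x h hx
      simp [h hx]
  have hsplit : ∀ u : Fin d → ℝ, ∏ r, (e (u r) * (ψ (u r) : ℂ)) =
      e (∑ r, u r) * ((∏ r, ψ (u r) : ℝ) : ℂ) := by
    intro u
    rw [Finset.prod_mul_distrib, he, ← Complex.exp_sum, Complex.ofReal_prod]
    congr 2
    push_cast
    simp only [Finset.mul_sum]
  have hintd : Integrable (fun u : Fin d → ℝ => e (∑ r, u r) * ((∏ r, ψ (u r) : ℝ) : ℂ)) := by
    simp only [← hsplit]
    exact Integrable.fintype_prod fun _ => hint1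
  have hned : ∫ u : Fin d → ℝ, e (∑ r, u r) * ((∏ r, ψ (u r) : ℝ) : ℂ) ≠ 0 := by
    simp only [← hsplit]
    rw [integral_fintype_prod_volume_eq_prod (fun _ x => e x * (ψ x : ℂ))]
    exact Finset.prod_ne_zero_iff.2 fun _ _ => hne1
  by_cases hre : ∫ u : Fin d → ℝ, (e (∑ r, u r)).re * ∏ r, ψ (u r) = 0
  · refine ⟨fun x => (e x).im, |ω|, fun x => congrArg Complex.im (hper x),
      fun x => (Complex.abs_im_le_norm _).trans (hnorm x).le,
      fun x y => (Complex.abs_im_le_norm (e x - e y)).trans (hlip x y), fun him => hned ?_⟩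
    rw [← integral_re_add_im hintd]
    simp [hre, him, -Complex.ofReal_prod]
  · exact ⟨fun x => (e x).re, |ω|, fun x => congrArg Complex.re (hper x),
      fun x => (Complex.abs_re_le_norm _).trans (hnorm x).le,
      fun x y => (Complex.abs_re_le_norm (e x - e y)).trans (hlip x y), hre⟩

/-- A pointwise bound and a pointwise Hölder bound give membership in the Hölder ball. -/
theorem mem_holderBall1_of_forall_le {α K A B : ℝ} {h : ℝ → ℝ} (hK : 0 ≤ K)
    (hb : ∀ x, |h x| ≤ K / 2) (hh : ∀ x y, |h x - h y| ≤ K / 2 * |x - y| ^ α) :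
    h ∈ holderBall1 α K A B := by
  have hK2 : 0 ≤ K / 2 := by positivity
  have h1 : (⨆ x ∈ Set.Icc A B, |h x|) ≤ K / 2 :=
    Real.iSup_le (fun x => Real.iSup_le (fun _ => hb x) hK2) hK2
  have h2 : (⨆ x ∈ Set.Icc A B, ⨆ y ∈ Set.Icc A B, |h x - h y| / |x - y| ^ α) ≤ K / 2 :=
    Real.iSup_le (fun x => Real.iSup_le (fun _ => Real.iSup_le (fun y => Real.iSup_le
      (fun _ => div_le_of_le_mul₀ (by positivity) hK2 (hh x y)) hK2) hK2) hK2) hK2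
  exact (add_le_add h1 h2).trans_eq (add_halves K)

/-- A function bounded by one and `L`-Lipschitz is `α`-Hölder for every `α ∈ [0, 1]`. -/
theorem abs_sub_le_mul_rpow_of_lipschitz {g : ℝ → ℝ} {L α : ℝ} (hα0 : 0 ≤ α) (hα1 : α ≤ 1)
    (hb : ∀ x, |g x| ≤ 1) (hL : ∀ x y, |g x - g y| ≤ L * |x - y|) (x y : ℝ) :
    |g x - g y| ≤ max L 2 * |x - y| ^ α := by
  have hM : 0 ≤ max L 2 := zero_le_two.trans (le_max_right _ _)
  rcases le_total |x - y| 1 with h | h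
  · calc |g x - g y| ≤ L * |x - y| := hL x y
      _ ≤ max L 2 * |x - y| ^ α := by
        refine mul_le_mul (le_max_left _ _) ?_ (abs_nonneg _) hM
        rcases (abs_nonneg (x - y)).eq_or_lt with h0 | h0
        · rw [← h0]; positivity
        · simpa using Real.rpow_le_rpow_of_exponent_ge h0 h hα1
  · calc |g x - g y| ≤ |g x| + |g y| := abs_sub _ _
      _ ≤ 2 * 1 := by linarith [hb x, hb y]
      _ ≤ max L 2 * |x - y| ^ α :=
        mul_le_mul (le_max_right _ _) (Real.one_le_rpow h hα0) zero_le_one hM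

/-- Lemma on wavelet-coefficient decay for generalized additive
Hölder functions. -/
theorem statement5 (dd q : ℕ) (hd : 1 ≤ dd) (hq : 1 ≤ q)
    (ψ : ℝ → ℝ) (hψm : Measurable ψ) (hψb : ∃ M : ℝ, ∀ x, |ψ x| ≤ M)
    (hψne : ¬ ψ =ᵐ[(volume : Measure ℝ)] 0)
    (hψsupp : ∀ x : ℝ, x ∉ Set.Icc (0 : ℝ) (2 ^ q) → ψ x = 0) :
    ∃ c : ℝ, c ≠ 0 ∧
    ∀ α K : ℝ, 0 < α → α ≤ 1 → 0 < K →
    ∀ j : ℕ, q + (Nat.clog 2 dd + 1) ≤ j →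
    ∃ h ∈ holderBall1 α K 0 dd,
      ∀ p : Fin dd → ℕ, (∀ r, p r < 2 ^ (j - q - (Nat.clog 2 dd + 1))) →
        (∫ x in unitCube dd, h (∑ r, x r) *
            ∏ r, (2 : ℝ) ^ ((j : ℝ) / 2) *
              ψ ((2 : ℝ) ^ j * x r - ((2 ^ (q + (Nat.clog 2 dd + 1)) * p r : ℕ) : ℝ))) =
          c * K * (2 : ℝ) ^ (-((j : ℝ) / 2) * (2 * α + (dd : ℝ))) := by
  obtain ⟨M, hM⟩ := hψb
  set N : ℕ := 2 ^ (q + (Nat.clog 2 dd + 1)) with hN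
  have hqN : (2 : ℝ) ^ q ≤ N := by
    rw [hN]
    exact_mod_cast Nat.pow_le_pow_right two_pos (Nat.le_add_right _ _)
  obtain ⟨g, L, hper, hgb, hgL, hne⟩ := exists_periodic_lipschitz_integral_ne_zero dd
    (T := N) (lt_of_lt_of_le (by positivity) hqN) hψm hM hψne
    (fun x hx => hψsupp x fun h => hx ⟨h.1, h.2.trans hqN⟩)
  set I := ∫ u : Fin dd → ℝ, g (∑ r, u r) * ∏ r, ψ (u r) with hI
  set C := max L 2 with hC
  have hC2 : 2 ≤ C := le_max_right _ _
  refine ⟨I / (2 * C), by positivity, ?_⟩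
  intro α K hα0 hα1 hK j hj
  set s : ℝ := (2 : ℝ) ^ (-((j : ℝ) * α)) with hs
  have hs0 : 0 < s := by positivity
  have hs1 : s ≤ 1 := Real.rpow_le_one_of_one_le_of_nonpos one_le_two
    (neg_nonpos.2 (by positivity))
  refine ⟨fun t => K / (2 * C) * s * g (2 ^ j * t),
    mem_holderBall1_of_forall_le hK.le (fun x => ?_) (fun x y => ?_), ?_⟩
  · rw [abs_mul, abs_of_nonneg (by positivity)]
    calc K / (2 * C) * s * |g (2 ^ j * x)| ≤ K / (2 * 1) * 1 * 1 := by
          gcongr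
          · linarith
          · exact hgb _
      _ = K / 2 := by ring
  · have hscale : s * |(2 : ℝ) ^ j * x - 2 ^ j * y| ^ α = |x - y| ^ α := by
      rw [← mul_sub, abs_mul, abs_of_pos (by positivity : (0 : ℝ) < 2 ^ j),
        Real.mul_rpow (by positivity) (abs_nonneg _), ← Real.rpow_natCast_mul zero_le_two,
        ← mul_assoc, hs, ← Real.rpow_add two_pos]
      simp
    rw [← mul_sub, abs_mul, abs_of_nonneg (by positivity)]
    calc K / (2 * C) * s * |g (2 ^ j * x) - g (2 ^ j * y)|
        ≤ K / (2 * C) * s * (C * |(2 : ℝ) ^ j * x - 2 ^ j * y| ^ α) := by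
          gcongr
          exact abs_sub_le_mul_rpow_of_lipschitz hα0.le hα1 hgb hgL _ _
      _ = K / (2 * C) * C * (s * |(2 : ℝ) ^ j * x - 2 ^ j * y| ^ α) := by ring
      _ = K / 2 * |x - y| ^ α := by rw [hscale]; field_simp
  · intro p hp
    set b : Fin dd → ℝ := fun r => ((N * p r : ℕ) : ℝ) with hb
    set G : (Fin dd → ℝ) → ℝ := fun u => g (∑ r, u r) * ∏ r, ψ (u r) with hG
    rw [setIntegral_eq_integral_of_forall_compl_eq_zero]
    · have hcongr : ∀ x : Fin dd → ℝ, K / (2 * C) * s * g (2 ^ j * ∑ r, x r) *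
          ∏ r, (2 : ℝ) ^ ((j : ℝ) / 2) * ψ (2 ^ j * x r - ((N * p r : ℕ) : ℝ)) =
          K / (2 * C) * s * ((2 : ℝ) ^ ((j : ℝ) / 2)) ^ dd *
            G ((2 : ℝ) ^ j • x - b) := by
        intro x
        have harg : g (2 ^ j * ∑ r, x r) = g (∑ r, ((2 : ℝ) ^ j • x - b) r) := by
          have hsum : ∑ r, ((2 : ℝ) ^ j • x - b) r =
              2 ^ j * ∑ r, x r - ((∑ r, p r : ℕ) : ℝ) * N := by
            simp only [Pi.sub_apply, Pi.smul_apply, smul_eq_mul, Finset.sum_sub_distrib,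
              Finset.mul_sum, hb]
            push_cast
            rw [Finset.sum_mul]
            simp only [mul_comm]
          rw [hsum, (hper.nat_mul _).sub_eq]
        rw [Finset.prod_mul_distrib, Finset.prod_const, Finset.card_univ, Fintype.card_fin, harg,
          hG]
        simp only [Pi.sub_apply, Pi.smul_apply, smul_eq_mul, hb]
        ring
      simp only [hcongr]
      rw [integral_const_mul, Measure.integral_comp_smul volume (fun y => G (y - b)),
        integral_sub_right_eq_self, Module.finrank_fin_fun, abs_of_pos (by positivity),
        smul_eq_mul, ← hI]
      have hpow : s * ((2 : ℝ) ^ ((j : ℝ) / 2)) ^ dd * (((2 : ℝ) ^ j) ^ dd)⁻¹ =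
          (2 : ℝ) ^ (-((j : ℝ) / 2) * (2 * α + (dd : ℝ))) := by
        rw [hs, ← Real.rpow_natCast 2 j, ← Real.rpow_mul_natCast zero_le_two,
          ← Real.rpow_mul_natCast zero_le_two, ← Real.rpow_neg zero_le_two,
          ← Real.rpow_add two_pos, ← Real.rpow_add two_pos]
        congr 1
        ring
      rw [← hpow]
      ring
    · intro x hx
      simp only [unitCube, Set.mem_ofPred_eq, not_forall] at hx
      obtain ⟨r, hr⟩ := hx
      refine mul_eq_zero_of_right _ (Finset.prod_eq_zero (Finset.mem_univ r)
        (mul_eq_zero_of_right _ (hψsupp _ fun hmem => hr ?_)))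
      have h2j : (0 : ℝ) < 2 ^ j := by positivity
      have hle : ((N * p r : ℕ) : ℝ) + N ≤ 2 ^ j := by
        have : N * p r + N ≤ 2 ^ j := by
          calc N * p r + N = N * (p r + 1) := by ring
            _ ≤ N * 2 ^ (j - q - (Nat.clog 2 dd + 1)) := Nat.mul_le_mul_left _ (hp r)
            _ = 2 ^ j := by
              rw [hN, ← pow_add]
              congr 1
              omega
        exact_mod_cast this
      have hnn : (0 : ℝ) ≤ ((N * p r : ℕ) : ℝ) := Nat.cast_nonneg _
      constructor
      · by_contra! hneg
        nlinarith [hmem.1]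
      · by_contra! hgt
        nlinarith [hmem.2]

end
end

section
/- Removal of inactive nodes. For any L ∈ ℕ, any width vector p = (p₀,…,p_{L+1}) ∈ ℕ^{L+2} and any s ∈ ℕ, every function f ∈ F(L,p,s) also belongs to F(L, (p₀, min(p₁,s), min(p₂,s), …, min(p_L,s), p_{L+1}), s); that is, f can be realized by a ReLU network with the same depth and sparsity in which every hidden layer has width at most s. Consequently F(L,p,s) = F(L,(p₀, p₁∧s, …, p_L∧s, p_{L+1}), s). -/
open MeasureTheory ProbabilityTheory

noncomputable section

/-! ## Transporting a network along partial matchings of its nodes -/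

/-- A vector transported along a partial matching, extended by zero. -/
def transportVec {a b : ℕ} (r : Fin a ≃. Fin b) (v : Fin a → ℝ) : Fin b → ℝ :=
  fun j => (r.symm j).elim 0 v

/-- A matrix transported along partial matchings of its rows and columns, extended by zero. -/
def transportMat {a a' b b' : ℕ} (t : Fin b ≃. Fin b') (r : Fin a ≃. Fin a')
    (W : Matrix (Fin b) (Fin a) ℝ) : Matrix (Fin b') (Fin a') ℝ :=
  fun j => (t.symm j).elim 0 fun i => transportVec r (W i)

section Transport

variable {a a' b b' : ℕ}

theorem transportVec_apply {r : Fin a ≃. Fin b} {i : Fin a} {j : Fin b} (h : r i = some j)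
    (v : Fin a → ℝ) : transportVec r v j = v i := by
  simp [transportVec, (PEquiv.eq_some_iff r).2 h]

theorem transportMat_apply {t : Fin b ≃. Fin b'} {i : Fin b} {j : Fin b'} (h : t i = some j)
    (r : Fin a ≃. Fin a') (W : Matrix (Fin b) (Fin a) ℝ) :
    transportMat t r W j = transportVec r (W i) := by
  simp [transportMat, (PEquiv.eq_some_iff t).2 h]

theorem exists_of_transportVec_ne_zero {r : Fin a ≃. Fin b} {v : Fin a → ℝ} {j : Fin b}
    (h : transportVec r v j ≠ 0) : ∃ i, r i = some j ∧ v i ≠ 0 := by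
  rcases hj : r.symm j with _ | i
  · simp [transportVec, hj] at h
  · have hi := (PEquiv.eq_some_iff r).1 hj
    exact ⟨i, hi, by rwa [transportVec_apply hi] at h⟩

theorem exists_of_transportMat_ne_zero {t : Fin b ≃. Fin b'} {r : Fin a ≃. Fin a'}
    {W : Matrix (Fin b) (Fin a) ℝ} {j : Fin b'} {k : Fin a'} (h : transportMat t r W j k ≠ 0) :
    ∃ i l, t i = some j ∧ r l = some k ∧ W i l ≠ 0 := by
  rcases hj : t.symm j with _ | i
  · simp [transportMat, hj] at h
  · have hi := (PEquiv.eq_some_iff t).1 hj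
    rw [transportMat_apply hi] at h
    obtain ⟨l, hl, hW⟩ := exists_of_transportVec_ne_zero h
    exact ⟨i, l, hi, hl, hW⟩

theorem abs_transportVec_le {r : Fin a ≃. Fin b} {v : Fin a → ℝ} {c : ℝ} (hc : 0 ≤ c)
    (hv : ∀ i, |v i| ≤ c) (j : Fin b) : |transportVec r v j| ≤ c := by
  by_cases h : transportVec r v j = 0
  · simpa [h] using hc
  · obtain ⟨i, hi, -⟩ := exists_of_transportVec_ne_zero h
    simpa [transportVec_apply hi] using hv i

theorem abs_transportMat_le {t : Fin b ≃. Fin b'} {r : Fin a ≃. Fin a'}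
    {W : Matrix (Fin b) (Fin a) ℝ} {c : ℝ} (hc : 0 ≤ c) (hW : ∀ i l, |W i l| ≤ c)
    (j : Fin b') (k : Fin a') : |transportMat t r W j k| ≤ c := by
  by_cases h : transportMat t r W j k = 0
  · simpa [h] using hc
  · obtain ⟨i, l, hi, hl, -⟩ := exists_of_transportMat_ne_zero h
    simpa [transportMat_apply hi, transportVec_apply hl] using hW i l

theorem vecSupp_transportVec_le (r : Fin a ≃. Fin b) (v : Fin a → ℝ) :
    vecSupp (transportVec r v) ≤ vecSupp v := by
  classical
  simp only [vecSupp, Set.ncard_eq_toFinset_card']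
  refine Finset.card_le_card_of_forall_subsingleton (fun j i => r i = some j) ?_ ?_
  · intro j hj
    obtain ⟨i, hi, hv⟩ := exists_of_transportVec_ne_zero (by simpa using hj)
    exact ⟨i, by simpa using hv, hi⟩
  · rintro i - j ⟨-, hj⟩ j' ⟨-, hj'⟩
    exact Option.some.inj (hj.symm.trans hj')

theorem matSupp_transportMat_le (t : Fin b ≃. Fin b') (r : Fin a ≃. Fin a')
    (W : Matrix (Fin b) (Fin a) ℝ) : matSupp (transportMat t r W) ≤ matSupp W := by
  classical
  simp only [matSupp, Set.ncard_eq_toFinset_card']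
  refine Finset.card_le_card_of_forall_subsingleton
    (fun p q => t q.1 = some p.1 ∧ r q.2 = some p.2) ?_ ?_
  · intro p hp
    obtain ⟨i, l, hi, hl, hW⟩ := exists_of_transportMat_ne_zero (by simpa using hp)
    exact ⟨(i, l), by simpa using hW, hi, hl⟩
  · rintro q - p ⟨-, hp⟩ p' ⟨-, hp'⟩
    exact Prod.ext (Option.some.inj (hp.1.symm.trans hp'.1))
      (Option.some.inj (hp.2.symm.trans hp'.2))

theorem sum_transportVec_mul {r : Fin a ≃. Fin b} {w y : Fin a → ℝ} {y' : Fin b → ℝ}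
    (hw : ∀ i, r i = none → w i = 0) (hy : ∀ i j, r i = some j → y' j = y i) :
    ∑ j, transportVec r w j * y' j = ∑ i, w i * y i := by
  classical
  symm
  refine Finset.sum_bij_ne_zero
    (fun i _ h => (r i).get (Option.isSome_iff_ne_none.2 fun hi => h (by simp [hw i hi])))
    (fun _ _ _ => Finset.mem_univ _) ?_ ?_ ?_
  · intro i _ _ i' _ _ h
    exact r.inj (Option.get_mem _) (h.symm ▸ Option.get_mem _)
  · intro j _ h
    obtain ⟨i, hi, hwi⟩ := exists_of_transportVec_ne_zero (left_ne_zero_of_mul h)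
    rw [transportVec_apply hi, hy i j hi] at h
    exact ⟨i, Finset.mem_univ _, h, by simp [hi]⟩
  · intro i _ h
    have hi : r i = some ((r i).get
      (Option.isSome_iff_ne_none.2 fun hi => h (by simp [hw i hi]))) := by simp
    rw [transportVec_apply hi, hy _ _ hi]

end Transport

theorem netLayers_transport {L : ℕ} {a b : ℕ → ℕ} (r : ∀ i, Fin (a i) ≃. Fin (b i))
    (W : ∀ i, Matrix (Fin (a (i + 1))) (Fin (a i)) ℝ) (v : ∀ i, Fin (a i) → ℝ)
    (hW : ∀ i ≤ L, ∀ k, r i k = none → ∀ j, W i j k = 0)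
    {x : Fin (a 0) → ℝ} {x' : Fin (b 0) → ℝ} (hx : ∀ k k', r 0 k = some k' → x' k' = x k) :
    ∀ m ≤ L, ∀ j j', r (m + 1) j = some j' →
      netLayers b (fun i => transportMat (r (i + 1)) (r i) (W i)) (fun i => transportVec (r i) (v i))
        x' m j' = netLayers a W v x m j
  | 0, hm, j, j', hj => by
    simp only [netLayers, Matrix.mulVec, dotProduct, transportMat_apply hj]
    exact sum_transportVec_mul (fun k hk => hW 0 hm k hk j) hx
  | m + 1, hm, j, j', hj => by
    simp only [netLayers, Matrix.mulVec, dotProduct, transportMat_apply hj]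
    refine sum_transportVec_mul (fun k hk => hW (m + 1) hm k hk j) fun k k' hk => ?_
    simp only [shiftAct, transportVec_apply hk,
      netLayers_transport r W v hW hx m (by omega) k k' hk]

theorem mem_sparseNetClass_of_transport {L s : ℕ} {a b : ℕ → ℕ}
    (r : ∀ i, Fin (a i) ≃. Fin (b i))
    {W : ∀ i, Matrix (Fin (a (i + 1))) (Fin (a i)) ℝ} {v : ∀ i, Fin (a i) → ℝ}
    (hW1 : ∀ i j k, |W i j k| ≤ 1) (hv1 : ∀ i j, |v i j| ≤ 1) (hs : totalSparsity L a W v ≤ s)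
    (hW : ∀ i ≤ L, ∀ k, r i k = none → ∀ j, W i j k = 0)
    (h0 : b 0 = a 0) (hL : b (L + 1) = a (L + 1))
    (hr0 : ∀ k k', r 0 k = some k' → k = Fin.cast h0 k')
    (hrL : ∀ j', r (L + 1) (Fin.cast hL j') = some j') :
    (fun (x : Fin (b 0) → ℝ) (k : Fin (b (L + 1))) =>
      networkFun L a W v (fun j => x (Fin.cast h0.symm j)) (Fin.cast hL k)) ∈
        SparseNetClass L b s := by
  refine ⟨fun i => transportMat (r (i + 1)) (r i) (W i), fun i => transportVec (r i) (v i),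
    fun i => abs_transportMat_le zero_le_one (hW1 i),
    fun i => abs_transportVec_le zero_le_one (hv1 i), ?_, ?_⟩
  · refine le_trans (add_le_add ?_ ?_) hs
    · exact Finset.sum_le_sum fun i _ => matSupp_transportMat_le _ _ _
    · exact Finset.sum_le_sum fun i _ => vecSupp_transportVec_le _ _
  · funext x k
    refine (netLayers_transport r W v hW (fun j j' hj => ?_) L le_rfl _ _ (hrL k)).symm
    simp [hr0 j j' hj]

/-- A set of at most `m` coordinates extends to a partial matching onto `Fin m`. -/
theorem exists_pequiv_fin {n m : ℕ} (S : Finset (Fin n)) (hS : S.card ≤ m) (hmn : m ≤ n) :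
    ∃ r : Fin n ≃. Fin m, (∀ k, r k = none → k ∉ S) ∧ ∀ j, r.symm j ≠ none := by
  obtain ⟨T, hST, hT⟩ := Finset.exists_superset_card_eq hS (by simpa using hmn)
  let e : T ≃ Fin m := T.equivFinOfCardEq hT
  refine ⟨⟨fun k => if h : k ∈ T then some (e ⟨k, h⟩) else none,
    fun j => some (e.symm j), fun k j => ?_⟩, fun k hk hkS => ?_, fun j => Option.some_ne_none _⟩
  · by_cases h : k ∈ T
    · simp only [h, Option.some.injEq, dite_true]
      constructor
      · rintro rfl
        simp
      · rintro rfl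
        simp
    · simp only [h, Option.some.injEq, dite_false, reduceCtorEq, iff_false]
      rintro rfl
      exact h (e.symm j).2
  · simp [hST hkS] at hk

/-- The number of nonzero columns of a matrix is at most its number of nonzero entries. -/
theorem card_nonzero_cols_le_matSupp {a b : ℕ} (W : Matrix (Fin b) (Fin a) ℝ)
    (S : Finset (Fin a)) (hS : ∀ k ∈ S, ∃ j, W j k ≠ 0) : S.card ≤ matSupp W := by
  classical
  rw [matSupp, Set.ncard_eq_toFinset_card']
  refine Finset.card_le_card_of_forall_subsingleton (fun k q => q.2 = k) ?_ ?_
  · intro k hk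
    obtain ⟨j, hj⟩ := hS k hk
    exact ⟨(j, k), by simpa using hj, rfl⟩
  · rintro q - k ⟨-, hk⟩ k' ⟨-, hk'⟩
    exact hk.symm.trans hk'

theorem matSupp_le_totalSparsity {L : ℕ} {p : ℕ → ℕ}
    (W : ∀ i, Matrix (Fin (p (i + 1))) (Fin (p i)) ℝ) (v : ∀ i, Fin (p i) → ℝ) {i : ℕ}
    (hi : i ≤ L) : matSupp (W i) ≤ totalSparsity L p W v :=
  le_add_right (Finset.single_le_sum (f := fun i => matSupp (W i)) (fun _ _ => Nat.zero_le _)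
    (Finset.mem_range.2 (by omega)))

/-- If every hidden layer of `q` has `min (p i) s` nodes, the nodes of `p` can be partially matched
with those of `q`, covering `q` and all nodes with a nonzero outgoing weight. -/
theorem exists_pequiv_active_nodes {L s : ℕ} {p q : ℕ → ℕ}
    (h0 : q 0 = p 0) (hL : q (L + 1) = p (L + 1))
    (hmid : ∀ i, 1 ≤ i → i ≤ L → q i = min (p i) s)
    (W : ∀ i, Matrix (Fin (p (i + 1))) (Fin (p i)) ℝ) (hW : ∀ i ≤ L, matSupp (W i) ≤ s) :
    ∃ r : ∀ i, Fin (p i) ≃. Fin (q i),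
      (∀ i ≤ L, ∀ k, r i k = none → ∀ j, W i j k = 0) ∧
      (∀ i ≤ L, ∀ j, (r i).symm j ≠ none) ∧
      (∀ k, r 0 k = some (Fin.cast h0.symm k)) ∧
      ∀ k, r (L + 1) k = some (Fin.cast hL.symm k) := by
  classical
  have hidden (i : ℕ) : ∃ r : Fin (p i) ≃. Fin (q i), 1 ≤ i → i ≤ L →
      (∀ k, r k = none → ∀ j, W i j k = 0) ∧ ∀ j, r.symm j ≠ none := by
    by_cases hi : 1 ≤ i ∧ i ≤ L
    · have hq := hmid i hi.1 hi.2
      let S : Finset (Fin (p i)) := {k | ∃ j, W i j k ≠ 0}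
      have hSs : S.card ≤ s :=
        (card_nonzero_cols_le_matSupp (W i) S (by simp [S])).trans (hW i hi.2)
      have hSp : S.card ≤ p i := by simpa using S.card_le_univ
      obtain ⟨r, hr, hr'⟩ := exists_pequiv_fin (m := q i) S (by omega) (by omega)
      exact ⟨r, fun _ _ => ⟨fun k hk => by simpa [S] using hr k hk, hr'⟩⟩
    · exact ⟨⊥, fun h h' => absurd ⟨h, h'⟩ hi⟩
  choose r hr using hidden
  let r' (i : ℕ) : Fin (p i) ≃. Fin (q i) :=
    if h : q i = p i ∧ (i = 0 ∨ i = L + 1) then (finCongr h.1.symm).toPEquiv else r i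
  have hr'0 : r' 0 = (finCongr h0.symm).toPEquiv := dif_pos ⟨h0, Or.inl rfl⟩
  have hr'L : r' (L + 1) = (finCongr hL.symm).toPEquiv := dif_pos ⟨hL, Or.inr rfl⟩
  have hr'mid (i : ℕ) (h : 1 ≤ i) (h' : i ≤ L) : r' i = r i := dif_neg (by omega)
  refine ⟨r', fun i hi => ?_, fun i hi => ?_, fun k => ?_, fun k => ?_⟩
  · rcases Nat.eq_zero_or_pos i with rfl | h
    · simp [hr'0]
    · rw [hr'mid i h hi]
      exact (hr i h hi).1
  · rcases Nat.eq_zero_or_pos i with rfl | h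
    · simp [hr'0, ← Equiv.toPEquiv_symm]
    · rw [hr'mid i h hi]
      exact (hr i h hi).2
  · simp [hr'0]
  · simp [hr'L]

/-- removal of inactive nodes:
`F(L,p,s) = F(L,(p₀, p₁∧s, …, p_L∧s, p_{L+1}), s)`. -/
theorem statement11 (L s : ℕ) (p p' : ℕ → ℕ)
    (h0 : p' 0 = p 0) (hL1 : p' (L + 1) = p (L + 1))
    (hmid : ∀ i, 1 ≤ i → i ≤ L → p' i = min (p i) s)
    (f : (Fin (p 0) → ℝ) → Fin (p (L + 1)) → ℝ) :
    f ∈ SparseNetClass L p s ↔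
      (fun (x : Fin (p' 0) → ℝ) (k : Fin (p' (L + 1))) =>
          f (fun j => x (Fin.cast h0.symm j)) (Fin.cast hL1 k)) ∈
        SparseNetClass L p' s := by
  constructor
  · rintro ⟨W, v, hW1, hv1, hs, rfl⟩
    obtain ⟨r, hr, -, hr0, hrL⟩ := exists_pequiv_active_nodes h0 hL1 hmid W
      fun i hi => (matSupp_le_totalSparsity W v hi).trans hs
    refine mem_sparseNetClass_of_transport r hW1 hv1 hs hr h0 hL1 (fun k k' h => ?_) fun j => ?_
    · obtain rfl := Option.some.inj ((hr0 k).symm.trans h)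
      simp
    · simp [hrL]
  · rintro ⟨W, v, hW1, hv1, hs, hf⟩
    obtain ⟨r, -, hr, hr0, hrL⟩ := exists_pequiv_active_nodes h0 hL1 hmid (fun _ => 0)
      fun i _ => by simp [matSupp]
    have key := mem_sparseNetClass_of_transport (fun i => (r i).symm) hW1 hv1 hs
      (fun i hi k hk => absurd hk (hr i hi k)) h0.symm hL1.symm
      (fun k k' h => Option.some.inj (((PEquiv.eq_some_iff _).1 h).symm.trans (hr0 k')))
      fun j => (PEquiv.eq_some_iff _).2 (hrL j)
    rw [← hf] at key
    simpa using key

end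
end

section
/- Approximation of x(1−x) by iterated triangle waves (Lemma A.1). For each positive integer k define T^k : ℝ → ℝ by T^k(x) := max(x/2, 0) − max(x − 2^{1−2k}, 0), and define R^k := T^k ∘ T^{k−1} ∘ ⋯ ∘ T^1. Then for every positive integer m and every x ∈ [0,1], |x(1−x) − Σ_{k=1}^m R^k(x)| ≤ 2^{−m}. -/
open MeasureTheory ProbabilityTheory

noncomputable section

/-- `T^k(x) = (x/2)₊ - (x - 2^{1-2k})₊`. -/
def Tfun (k : ℕ) (x : ℝ) : ℝ :=
  max (x / 2) 0 - max (x - (2 : ℝ) ^ (1 - 2 * (k : ℤ))) 0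

/-- `R^k = T^k ∘ T^{k-1} ∘ ⋯ ∘ T^1`. -/
def Rfun : ℕ → ℝ → ℝ
  | 0 => fun x => x
  | k + 1 => fun x => Tfun (k + 1) (Rfun k x)

/-- With `c = 4⁻ᵏ`, the wave `T^{k+1}` equals `y ↦ min (y/2) ((c - y)/2)` on `y ≥ 0`. -/
lemma Tfun_succ_of_nonneg (k : ℕ) {y : ℝ} (hy : 0 ≤ y) :
    Tfun (k + 1) y = min (y / 2) ((((4 : ℝ) ^ k)⁻¹ - y) / 2) := by
  have hc : (2 : ℝ) ^ (1 - 2 * ((k + 1 : ℕ) : ℤ)) = ((4 : ℝ) ^ k)⁻¹ / 2 := by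
    rw [show (1 - 2 * ((k + 1 : ℕ) : ℤ)) = -((2 * k : ℕ) : ℤ) - 1 by push_cast; ring,
      zpow_sub₀ two_ne_zero, zpow_neg, zpow_natCast, pow_mul]
    norm_num
  rw [Tfun, hc, max_eq_left (by positivity)]
  rcases le_total y (((4 : ℝ) ^ k)⁻¹ / 2) with h | h
  · rw [max_eq_right (by linarith), min_eq_left (by linarith)]
    ring
  · rw [max_eq_left (by linarith), min_eq_right (by linarith)]
    ring

lemma Rfun_succ (k : ℕ) (x : ℝ) : Rfun (k + 1) x = Tfun (k + 1) (Rfun k x) := rfl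

lemma Rfun_mem_Icc (k : ℕ) {x : ℝ} (hx : x ∈ Set.Icc (0 : ℝ) 1) :
    Rfun k x ∈ Set.Icc 0 ((4 : ℝ) ^ k)⁻¹ := by
  induction k with
  | zero => simpa [Rfun] using hx
  | succ k ih =>
    obtain ⟨h0, h1⟩ := ih
    rw [Rfun_succ, Tfun_succ_of_nonneg k h0, pow_succ, mul_inv]
    refine ⟨le_min (by linarith) (by linarith), ?_⟩
    rcases le_total (Rfun k x) (((4 : ℝ) ^ k)⁻¹ / 2) with h | h
    · exact (min_le_left _ _).trans (by linarith)
    · exact (min_le_right _ _).trans (by linarith)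

/-- The remainder of the triangle wave expansion is a parabola in the last wave. -/
lemma parabola_sub_sum_Rfun (m : ℕ) {x : ℝ} (hx : x ∈ Set.Icc (0 : ℝ) 1) :
    x * (1 - x) - ∑ k ∈ Finset.Icc 1 m, Rfun k x = Rfun m x * (1 - 4 ^ m * Rfun m x) := by
  induction m with
  | zero => simp [Rfun]
  | succ m ih =>
    have hq : (4 : ℝ) ^ m * ((4 : ℝ) ^ m)⁻¹ = 1 := mul_inv_cancel₀ (by positivity)
    rw [Finset.sum_Icc_succ_top (by omega), ← sub_sub, ih, Rfun_succ,
      Tfun_succ_of_nonneg m (Rfun_mem_Icc m hx).1, pow_succ]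
    set c := ((4 : ℝ) ^ m)⁻¹
    rcases min_choice (Rfun m x / 2) ((c - Rfun m x) / 2) with h | h <;> rw [h]
    · ring
    · linear_combination (c - 2 * Rfun m x) * hq

/-- Lemma A.1: approximation of `x(1-x)` by iterated triangle
waves. -/
theorem statement12 (m : ℕ) (hm : 1 ≤ m) :
    ∀ x ∈ Set.Icc (0 : ℝ) 1,
      |x * (1 - x) - ∑ k ∈ Finset.Icc 1 m, Rfun k x| ≤ ((2 : ℝ) ^ m)⁻¹ := by
  intro x hx
  obtain ⟨h0, h1⟩ := Rfun_mem_Icc m hx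
  have hq : (4 : ℝ) ^ m * Rfun m x ≤ 1 := by
    simpa using mul_le_mul_of_nonneg_left h1 (by positivity : (0 : ℝ) ≤ 4 ^ m)
  have hq0 : 0 ≤ (4 : ℝ) ^ m * Rfun m x := by positivity
  rw [parabola_sub_sum_Rfun m hx, abs_of_nonneg (mul_nonneg h0 (by linarith))]
  calc Rfun m x * (1 - 4 ^ m * Rfun m x) ≤ Rfun m x :=
        mul_le_of_le_one_right h0 (by linarith)
    _ ≤ ((4 : ℝ) ^ m)⁻¹ := h1
    _ ≤ ((2 : ℝ) ^ m)⁻¹ := by gcongr; norm_num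

end
end

section
/- ReLU network approximating multiplication of two numbers (Lemma A.2). For any positive integer m there exists a ReLU network Mult_m ∈ F(m+4, (2,6,6,…,6,1)) — i.e., a network with input dimension 2, m+4 hidden layers each of width 6, output dimension 1, and all weight-matrix entries and shift-vector entries bounded in absolute value by 1 — such that Mult_m(x,y) ∈ [0,1] for all x,y ∈ [0,1], |Mult_m(x,y) − x·y| ≤ 2^{−m} for all x,y ∈ [0,1], and Mult_m(0,y) = Mult_m(x,0) = 0 for all x,y ∈ [0,1]. -/
open MeasureTheory ProbabilityTheory

noncomputable section

/-! ## Sawtooth interpolation of the parabola `x ↦ x * (1 - x)` -/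

/-- The `k`-fold composition of the rescaled tent maps `r ↦ min (r / 2) (4⁻ᵏ / 2 - r / 2)`. -/
def sawtooth (x : ℝ) : ℕ → ℝ
  | 0 => x
  | k + 1 => sawtooth x k / 2 - relu (sawtooth x k - (1 / 4) ^ k / 2)

/-- The sum of the first `k` sawtooth functions, a piecewise linear interpolation of
`x ↦ x * (1 - x)`. -/
def sawtoothSum (x : ℝ) : ℕ → ℝ
  | 0 => 0
  | k + 1 => sawtoothSum x k + sawtooth x (k + 1)

lemma relu_of_nonneg {x : ℝ} (h : 0 ≤ x) : relu x = x := max_eq_left h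

lemma relu_of_nonpos {x : ℝ} (h : x ≤ 0) : relu x = 0 := max_eq_right h

lemma sawtooth_mem (x : ℝ) (hx : x ∈ Set.Icc (0 : ℝ) 1) (k : ℕ) :
    sawtooth x k ∈ Set.Icc (0 : ℝ) ((1 / 4) ^ k) := by
  induction k with
  | zero => simpa [sawtooth] using hx
  | succ k ih =>
    obtain ⟨h0, h1⟩ := ih
    rw [sawtooth, pow_succ]
    rcases le_total (sawtooth x k - (1 / 4) ^ k / 2) 0 with h | h
    · rw [relu_of_nonpos h]
      constructor <;> linarith
    · rw [relu_of_nonneg h]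
      constructor <;> linarith

lemma sawtoothSum_nonneg (x : ℝ) (hx : x ∈ Set.Icc (0 : ℝ) 1) (k : ℕ) :
    0 ≤ sawtoothSum x k := by
  induction k with
  | zero => exact le_rfl
  | succ k ih => exact add_nonneg ih (sawtooth_mem x hx (k + 1)).1

lemma sawtoothSum_remainder (x : ℝ) (k : ℕ) :
    (1 / 4) ^ k * (x * (1 - x) - sawtoothSum x k) =
      sawtooth x k * ((1 / 4) ^ k - sawtooth x k) := by
  induction k with
  | zero => simp [sawtooth, sawtoothSum]
  | succ k ih =>
    rw [sawtoothSum, sawtooth, pow_succ]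
    rcases le_total (sawtooth x k - (1 / 4) ^ k / 2) 0 with h | h
    · rw [relu_of_nonpos h]
      linear_combination ih / 4
    · rw [relu_of_nonneg h]
      linear_combination ih / 4

lemma sawtoothSum_error (x : ℝ) (hx : x ∈ Set.Icc (0 : ℝ) 1) (k : ℕ) :
    x * (1 - x) - sawtoothSum x k ∈ Set.Icc (0 : ℝ) ((1 / 4) ^ k / 4) := by
  have hr := sawtoothSum_remainder x k
  obtain ⟨h0, h1⟩ := sawtooth_mem x hx k
  have hc : (0 : ℝ) < (1 / 4) ^ k := by positivity
  constructor
  · refine (mul_nonneg_iff_of_pos_left hc).1 (?_ : 0 ≤ (1 / 4 : ℝ) ^ k * _)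
    rw [hr]
    exact mul_nonneg h0 (by linarith)
  · refine le_of_mul_le_mul_left ?_ hc
    rw [hr]
    nlinarith [sq_nonneg (sawtooth x k - (1 / 4) ^ k / 2)]

lemma sawtooth_one_sub (x : ℝ) (k : ℕ) :
    sawtooth (1 - x) (k + 1) = sawtooth x (k + 1) := by
  induction k with
  | zero =>
    simp only [sawtooth, pow_zero]
    rcases le_total x (1 / 2) with h | h
    · rw [relu_of_nonneg (by linarith), relu_of_nonpos (by linarith)]
      ring
    · rw [relu_of_nonpos (by linarith), relu_of_nonneg (by linarith)]
      ring
  | succ k ih => rw [sawtooth, ih, ← sawtooth]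

lemma sawtoothSum_one_sub (x : ℝ) (k : ℕ) : sawtoothSum (1 - x) k = sawtoothSum x k := by
  induction k with
  | zero => rfl
  | succ k ih => rw [sawtoothSum, sawtoothSum, ih, sawtooth_one_sub]

lemma sawtooth_one_of_le_half (x : ℝ) (hx : x ≤ 1 / 2) : sawtooth x 1 = x / 2 := by
  simp only [sawtooth, pow_zero]
  rw [relu_of_nonpos (by linarith), sub_zero]

lemma sawtooth_half_sub (x : ℝ) (hx : x ∈ Set.Icc (0 : ℝ) (1 / 2)) (k : ℕ) :
    sawtooth (1 / 2 - x) (k + 2) = sawtooth x (k + 2) := by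
  obtain ⟨h0, h1⟩ := hx
  induction k with
  | zero =>
    rw [sawtooth, sawtooth.eq_2 x, sawtooth_one_of_le_half x h1,
      sawtooth_one_of_le_half (1 / 2 - x) (by linarith), pow_one]
    rcases le_total x (1 / 4) with h | h
    · rw [relu_of_nonneg (by linarith), relu_of_nonpos (by linarith)]
      ring
    · rw [relu_of_nonpos (by linarith), relu_of_nonneg (by linarith)]
      ring
  | succ k ih => rw [sawtooth, ih, ← sawtooth]

lemma sawtoothSum_half_sub (x : ℝ) (hx : x ∈ Set.Icc (0 : ℝ) (1 / 2)) (k : ℕ) :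
    sawtoothSum (1 / 2 - x) (k + 1) = sawtoothSum x (k + 1) + 1 / 4 - x := by
  induction k with
  | zero =>
    rw [sawtoothSum, sawtoothSum.eq_2 x, zero_add, sawtooth_one_of_le_half x hx.2,
      sawtooth_one_of_le_half (1 / 2 - x) (by linarith [hx.1]), sawtoothSum, sawtoothSum]
    ring
  | succ k ih =>
    rw [sawtoothSum, sawtoothSum.eq_2 x, ih, sawtooth_half_sub x hx]
    ring

/-! ## The approximate product and its properties -/

/-- Polarization `x * y = g ((x - y + 1) / 2) - g ((x + y) / 2) + (x + y) / 2 - 1 / 4` with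
`g t = t * (1 - t)` replaced by its interpolation `sawtoothSum t k`. -/
def approxProd (k : ℕ) (x y : ℝ) : ℝ :=
  sawtoothSum ((x - y + 1) / 2) k + (x + y) / 2 - sawtoothSum ((x + y) / 2) k - 1 / 4

/-- Clipping to `[0, 1]`, written as a difference of two ReLU units. -/
def clip (z : ℝ) : ℝ := relu z - relu (relu z - 1)

lemma clip_eq (z : ℝ) : clip z = min (max z 0) 1 := by
  rw [clip, relu, relu]
  rcases le_total (max z 0) 1 with h | h
  · rw [max_eq_right (by linarith : max z 0 - 1 ≤ 0), min_eq_left h, sub_zero]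
  · rw [max_eq_left (by linarith : 0 ≤ max z 0 - 1), min_eq_right h]
    ring

lemma clip_mem (z : ℝ) : clip z ∈ Set.Icc (0 : ℝ) 1 := by
  rw [clip_eq]
  exact ⟨le_min (le_max_right _ _) zero_le_one, min_le_right _ _⟩

lemma abs_clip_sub_le (z w : ℝ) (hw : w ∈ Set.Icc (0 : ℝ) 1) : |clip z - w| ≤ |z - w| := by
  have h : w = min (max w 0) 1 := by rw [max_eq_left hw.1, min_eq_left hw.2]
  rw [clip_eq]
  conv_lhs => rw [h]
  refine (abs_min_sub_min_le_max _ _ _ _).trans ?_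
  rw [sub_self, abs_zero, max_eq_left (abs_nonneg _)]
  exact abs_max_sub_max_le_abs _ _ _

lemma abs_approxProd_sub_le (k : ℕ) (x y : ℝ) (hx : x ∈ Set.Icc (0 : ℝ) 1)
    (hy : y ∈ Set.Icc (0 : ℝ) 1) : |approxProd k x y - x * y| ≤ (1 / 4) ^ k / 4 := by
  obtain ⟨hx0, hx1⟩ := hx
  obtain ⟨hy0, hy1⟩ := hy
  have hu := sawtoothSum_error ((x - y + 1) / 2) ⟨by linarith, by linarith⟩ k
  have hv := sawtoothSum_error ((x + y) / 2) ⟨by linarith, by linarith⟩ k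
  have h : approxProd k x y - x * y =
      ((x + y) / 2 * (1 - (x + y) / 2) - sawtoothSum ((x + y) / 2) k) -
      ((x - y + 1) / 2 * (1 - (x - y + 1) / 2) - sawtoothSum ((x - y + 1) / 2) k) := by
    rw [approxProd]
    ring
  rw [h, abs_le]
  constructor <;> linarith [hu.1, hu.2, hv.1, hv.2]

lemma approxProd_zero_left (k : ℕ) (y : ℝ) (hy : y ∈ Set.Icc (0 : ℝ) 1) :
    approxProd (k + 1) 0 y = 0 := by
  have h := sawtoothSum_half_sub (y / 2) ⟨by linarith [hy.1], by linarith [hy.2]⟩ k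
  rw [approxProd, show (0 - y + 1) / 2 = 1 / 2 - y / 2 by ring, h, zero_add]
  ring

lemma approxProd_zero_right (k : ℕ) (x : ℝ) (hx : x ∈ Set.Icc (0 : ℝ) 1) :
    approxProd (k + 1) x 0 = 0 := by
  refine Eq.trans ?_ (approxProd_zero_left k x hx)
  rw [approxProd, approxProd,
    show (x - 0 + 1) / 2 = 1 - (0 - x + 1) / 2 by ring, sawtoothSum_one_sub, add_comm x 0]

/-! ## The network -/

/-- The sequence with the six given leading entries and zeros afterwards. -/
def sixEntries (a b c d e f : ℝ) : ℕ → ℝ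
  | 0 => a
  | 1 => b
  | 2 => c
  | 3 => d
  | 4 => e
  | 5 => f
  | _ => 0

lemma abs_sixEntries_le {a b c d e f : ℝ} (ha : |a| ≤ 1) (hb : |b| ≤ 1) (hc : |c| ≤ 1)
    (hd : |d| ≤ 1) (he : |e| ≤ 1) (hf : |f| ≤ 1) (j : ℕ) : |sixEntries a b c d e f j| ≤ 1 := by
  unfold sixEntries
  split <;> first | assumption | simp

/-- Rows of the weight matrix of the input layer. -/
def inputRow : ℕ → ℕ → ℝ
  | 0 | 1 => sixEntries (1 / 2) (-1 / 2) 0 0 0 0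
  | 2 | 3 | 4 => sixEntries (1 / 2) (1 / 2) 0 0 0 0
  | _ => 0

/-- Rows of the weight matrix performing two sawtooth iterations in parallel. -/
def sawtoothRow : ℕ → ℕ → ℝ
  | 0 | 1 => sixEntries (1 / 2) (-1) 0 0 0 0
  | 2 => sixEntries (1 / 2) (-1) 1 0 0 0
  | 3 | 4 => sixEntries 0 0 0 (1 / 2) (-1) 0
  | 5 => sixEntries 0 0 0 (1 / 2) (-1) 1
  | _ => 0

/-- Entries of the weight matrices of the multiplication network. -/
def multWeight (m i j : ℕ) : ℕ → ℝ :=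
  if i = 0 then inputRow j
  else if i ≤ m + 1 then sawtoothRow j
  else if i = m + 2 then sixEntries 0 0 1 0 0 (-1)
  else if i = m + 3 then sixEntries 1 0 0 0 0 0
  else sixEntries 1 (-1) 0 0 0 0

/-- Entries of the shift vectors of the multiplication network. -/
def multShift (m i : ℕ) : ℕ → ℝ :=
  if i = 1 then sixEntries (-1 / 2) 0 0 0 (1 / 2) 0
  else if i ≤ m + 2 then sixEntries 0 ((1 / 4) ^ (i - 1) / 2) 0 0 ((1 / 4) ^ (i - 1) / 2) 0
  else if i = m + 3 then sixEntries (1 / 4) 0 0 0 0 0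
  else sixEntries 0 1 0 0 0 0

lemma abs_multWeight_le (m i j k : ℕ) : |multWeight m i j k| ≤ 1 := by
  unfold multWeight inputRow sawtoothRow
  split_ifs <;> (try split) <;>
    first
    | (apply abs_sixEntries_le <;> norm_num [abs_le])
    | simp

lemma abs_multShift_le (m i k : ℕ) : |multShift m i k| ≤ 1 := by
  have h (n : ℕ) : |((1 : ℝ) / 4) ^ n / 2| ≤ 1 := by
    rw [abs_of_nonneg (by positivity)]
    linarith [pow_le_one₀ (n := n) (by norm_num : (0 : ℝ) ≤ 1 / 4) (by norm_num)]
  unfold multShift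
  split_ifs <;> apply abs_sixEntries_le <;> first | exact h _ | norm_num [abs_le]

/-- The width vector `(2, 6, …, 6, 1)` with `m + 4` hidden layers. -/
abbrev multWidth (m : ℕ) : ℕ → ℕ := fun i => if i = 0 then 2 else if i = m + 5 then 1 else 6

/-- The values before activation in the multiplication network. -/
abbrev multLayers (m : ℕ) (x : Fin (multWidth m 0) → ℝ) (k : ℕ) :
    Fin (multWidth m (k + 1)) → ℝ :=
  netLayers (multWidth m) (fun i j k => multWeight m i j k) (fun i j => multShift m i j) x k

lemma multWidth_hidden {m k : ℕ} (hk : k < m + 4) : multWidth m (k + 1) = 6 := by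
  simp only [multWidth]
  rw [if_neg (by omega), if_neg (by omega)]

/-- One hidden layer of the multiplication network, given the values of its activated units. -/
lemma multLayers_succ {m k : ℕ} (hk : k < m + 4) (x : Fin (multWidth m 0) → ℝ) {s : ℕ → ℝ}
    (hs : ∀ j, relu (multLayers m x k j - multShift m (k + 1) j) = s j)
    (j : Fin (multWidth m (k + 2))) :
    multLayers m x (k + 1) j =
      ∑ i ∈ Finset.range 6, multWeight m (k + 1) j i * s i := by
  rw [← multWidth_hidden hk,
    ← Fin.sum_univ_eq_sum_range (fun i => multWeight m (k + 1) j i * s i) (multWidth m (k + 1))]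
  change ∑ i : Fin (multWidth m (k + 1)), multWeight m (k + 1) j i *
    relu (multLayers m x k i - multShift m (k + 1) i) = _
  simp only [hs]

/-- Activations of the hidden layers that carry out the sawtooth iterations. -/
lemma relu_multLayers {m : ℕ} {x y : ℝ} (hx : x ∈ Set.Icc (0 : ℝ) 1)
    (hy : y ∈ Set.Icc (0 : ℝ) 1) {X : Fin (multWidth m 0) → ℝ}
    (hX : ∀ i, X i = sixEntries x y 0 0 0 0 i) {k : ℕ} (hk : k ≤ m + 1)
    (j : Fin (multWidth m (k + 1))) :
    relu (multLayers m X k j - multShift m (k + 1) j) =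
      sixEntries (sawtooth ((x - y + 1) / 2) k)
        (relu (sawtooth ((x - y + 1) / 2) k - (1 / 4) ^ k / 2))
        (sawtoothSum ((x - y + 1) / 2) k + (x + y) / 2)
        (sawtooth ((x + y) / 2) k)
        (relu (sawtooth ((x + y) / 2) k - (1 / 4) ^ k / 2))
        (sawtoothSum ((x + y) / 2) k) j := by
  have hu : (x - y + 1) / 2 ∈ Set.Icc (0 : ℝ) 1 :=
    ⟨by linarith [hx.1, hy.2], by linarith [hx.2, hy.1]⟩
  have hv : (x + y) / 2 ∈ Set.Icc (0 : ℝ) 1 :=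
    ⟨by linarith [hx.1, hy.1], by linarith [hx.2, hy.2]⟩
  induction k with
  | zero =>
    have h : multLayers m X 0 j = inputRow j 0 * x + inputRow j 1 * y := by
      have h2 : multLayers m X 0 j =
          ∑ i : Fin (multWidth m 0), multWeight m 0 j i * sixEntries x y 0 0 0 0 i := by
        simp only [← hX]
        rfl
      rw [h2, Fin.sum_univ_eq_sum_range
        (fun i => multWeight m 0 j i * sixEntries x y 0 0 0 0 i) (multWidth m 0)]
      simp [multWidth, Finset.sum_range_succ, multWeight, sixEntries]
    have hj : (j : ℕ) < 6 := j.isLt.trans_eq (multWidth_hidden (by omega))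
    rw [h]
    generalize (j : ℕ) = n at hj ⊢
    interval_cases n <;>
      simp only [inputRow, multShift, sixEntries, sawtooth, sawtoothSum, if_true, pow_zero,
        zero_add, Pi.zero_apply]
    · refine Eq.trans (congrArg relu ?_) (relu_of_nonneg hu.1)
      ring
    · congr 1
      ring
    · refine Eq.trans (congrArg relu ?_) (relu_of_nonneg hv.1)
      ring
    · refine Eq.trans (congrArg relu ?_) (relu_of_nonneg hv.1)
      ring
    · congr 1
      ring
    · simp [relu]
  | succ k ih =>
    have hj : (j : ℕ) < 6 := j.isLt.trans_eq (multWidth_hidden (by omega))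
    rw [multLayers_succ (by omega) X (ih (by omega))]
    have hu0 := (sawtooth_mem _ hu (k + 1)).1
    have hv0 := (sawtooth_mem _ hv (k + 1)).1
    have hus := sawtoothSum_nonneg _ hu (k + 1)
    have hvs := sawtoothSum_nonneg _ hv (k + 1)
    have hp : 0 ≤ sawtoothSum ((x - y + 1) / 2) (k + 1) + (x + y) / 2 := add_nonneg hus hv.1
    have hw : multWeight m (k + 1) j = sawtoothRow j := by
      rw [multWeight, if_neg (by omega), if_pos hk]
    have hsh : multShift m (k + 1 + 1) =
        sixEntries 0 ((1 / 4) ^ (k + 1) / 2) 0 0 ((1 / 4) ^ (k + 1) / 2) 0 := by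
      rw [multShift, if_neg (by omega), if_pos (by omega), Nat.add_sub_cancel]
    rw [hw, hsh]
    generalize (j : ℕ) = n at hj ⊢
    interval_cases n <;>
      simp only [Finset.sum_range_succ, Finset.sum_range_zero, sawtoothRow, sixEntries]
    · refine Eq.trans (congrArg relu ?_) (relu_of_nonneg hu0)
      rw [sawtooth]
      ring
    · refine congrArg relu ?_
      rw [sawtooth]
      ring
    · refine Eq.trans (congrArg relu ?_) (relu_of_nonneg hp)
      rw [sawtoothSum, sawtooth]
      ring
    · refine Eq.trans (congrArg relu ?_) (relu_of_nonneg hv0)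
      rw [sawtooth]
      ring
    · refine congrArg relu ?_
      rw [sawtooth]
      ring
    · refine Eq.trans (congrArg relu ?_) (relu_of_nonneg hvs)
      rw [sawtoothSum, sawtooth]
      ring

lemma multLayers_output {m : ℕ} {x y : ℝ} (hx : x ∈ Set.Icc (0 : ℝ) 1)
    (hy : y ∈ Set.Icc (0 : ℝ) 1) {X : Fin (multWidth m 0) → ℝ}
    (hX : ∀ i, X i = sixEntries x y 0 0 0 0 i) (j : Fin (multWidth m (m + 4 + 1))) :
    multLayers m X (m + 4) j = clip (approxProd (m + 1) x y) := by
  have h2 (j) : multLayers m X (m + 2) j = approxProd (m + 1) x y + 1 / 4 := by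
    rw [multLayers_succ (by omega) X (relu_multLayers hx hy hX le_rfl)]
    simp [Finset.sum_range_succ, multWeight, sixEntries, approxProd]
    ring
  have h3 (j) : multLayers m X (m + 3) j = relu (approxProd (m + 1) x y) := by
    rw [multLayers_succ (by omega) X
      (s := fun j => relu (approxProd (m + 1) x y + 1 / 4 - multShift m (m + 3) j))
      fun j => by rw [h2 j]]
    simp [Finset.sum_range_succ, multWeight, multShift, sixEntries]
  rw [multLayers_succ (by omega) X
    (s := fun j => relu (relu (approxProd (m + 1) x y) - multShift m (m + 4) j))
    fun j => by rw [h3 j]]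
  have h0 : relu (relu (approxProd (m + 1) x y)) = relu (approxProd (m + 1) x y) :=
    relu_of_nonneg (le_max_right _ _)
  simp [Finset.sum_range_succ, multWeight, multShift, sixEntries, clip, h0]
  ring

/-- Lemma A.2: ReLU network approximately multiplying two
numbers. -/
theorem statement13 (m : ℕ) (hm : 1 ≤ m) :
    ∃ Mult : (Fin 2 → ℝ) → ℝ,
      Mult ∈ ScalarNetClassD 2 (m + 4)
          (fun i => if i = 0 then 2 else if i = m + 5 then 1 else 6) ∧
      (∀ x y : ℝ, x ∈ Set.Icc (0 : ℝ) 1 → y ∈ Set.Icc (0 : ℝ) 1 →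
        Mult ![x, y] ∈ Set.Icc (0 : ℝ) 1 ∧
        |Mult ![x, y] - x * y| ≤ ((2 : ℝ) ^ m)⁻¹) ∧
      (∀ x y : ℝ, x ∈ Set.Icc (0 : ℝ) 1 → y ∈ Set.Icc (0 : ℝ) 1 →
        Mult ![(0 : ℝ), y] = 0 ∧ Mult ![x, (0 : ℝ)] = 0) := by
  have hpos : 0 < multWidth m (m + 4 + 1) := by simp [multWidth]
  let Mult : (Fin 2 → ℝ) → ℝ := fun x => multLayers m x (m + 4) ⟨0, hpos⟩
  have hM (x y : ℝ) (hx : x ∈ Set.Icc (0 : ℝ) 1) (hy : y ∈ Set.Icc (0 : ℝ) 1) :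
      Mult ![x, y] = clip (approxProd (m + 1) x y) := by
    refine multLayers_output hx hy (fun i => ?_) _
    change Fin 2 at i
    fin_cases i <;> rfl
  have h01 : (0 : ℝ) ∈ Set.Icc (0 : ℝ) 1 := ⟨le_rfl, zero_le_one⟩
  have hc : clip 0 = 0 := by simp [clip_eq]
  refine ⟨Mult, ⟨rfl, _, ⟨_, _, fun i j k => abs_multWeight_le m i j k,
    fun i j => abs_multShift_le m i j, rfl⟩, fun x j => ?_⟩, fun x y hx hy => ⟨?_, ?_⟩,
    fun x y hx hy => ⟨?_, ?_⟩⟩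
  · have hone : multWidth m (m + 4 + 1) = 1 := by simp [multWidth]
    have hj : j = ⟨0, hpos⟩ := Fin.ext (Nat.lt_one_iff.1 (j.isLt.trans_eq hone))
    rw [hj]
    rfl
  · rw [hM x y hx hy]
    exact clip_mem _
  · rw [hM x y hx hy]
    have hxy : x * y ∈ Set.Icc (0 : ℝ) 1 :=
      ⟨mul_nonneg hx.1 hy.1, mul_le_one₀ hx.2 hy.1 hy.2⟩
    refine (abs_clip_sub_le _ _ hxy).trans ((abs_approxProd_sub_le _ x y hx hy).trans ?_)
    have h : ((1 : ℝ) / 4) ^ m ≤ (1 / 2) ^ m := pow_le_pow_left₀ (by norm_num) (by norm_num) m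
    have h' : (0 : ℝ) ≤ (1 / 4) ^ m := by positivity
    rw [← inv_pow, ← one_div, pow_succ]
    linarith
  · rw [hM 0 y h01 hy, approxProd_zero_left m y hy, hc]
  · rw [hM x 0 hx h01, approxProd_zero_right m x hx, hc]

end
end

section
/- ReLU network simultaneously approximating all monomials up to degree γ (Lemma A.4). Let r be a positive integer, γ > 0, and let C_{r,γ} denote the number of multi-indices α ∈ ℕ₀^r with |α| = α₁+…+α_r < γ. For any positive integer m there exists a ReLU network Mon_{m,γ}^r ∈ F(1 + (m+5)·⌈log₂(max(γ,1))⌉, (r, 6⌈γ⌉C_{r,γ}, …, 6⌈γ⌉C_{r,γ}, C_{r,γ})) — input dimension r, hidden layers of width 6⌈γ⌉C_{r,γ}, output dimension C_{r,γ}, all parameters bounded in absolute value by 1 — such that Mon_{m,γ}^r(x) ∈ [0,1]^{C_{r,γ}} and max over multi-indices α with |α| < γ of |(Mon_{m,γ}^r(x))_α − x^α| ≤ γ²·2^{−m} for all x ∈ [0,1]^r, where x^α := x₁^{α₁}⋯x_r^{α_r}. -/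
open MeasureTheory ProbabilityTheory

noncomputable section

/-! ## Building networks layer by layer -/

lemma netLayers_congr {p : ℕ → ℕ} {W W' : ∀ i, Matrix (Fin (p (i + 1))) (Fin (p i)) ℝ}
    {v v' : ∀ i, Fin (p i) → ℝ} (x : Fin (p 0) → ℝ) (k : ℕ)
    (hW : ∀ i ≤ k, W i = W' i) (hv : ∀ i ≤ k, v i = v' i) :
    netLayers p W v x k = netLayers p W' v' x k := by
  induction k with
  | zero => simp only [netLayers, hW 0 le_rfl]
  | succ k ih =>
    simp only [netLayers]
    rw [hW _ le_rfl, hv _ le_rfl, ih (fun i hi => hW i (hi.trans k.le_succ))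
      (fun i hi => hv i (hi.trans k.le_succ))]

/-- The functions `F` are computed, on the set `X`, by distinct neurons of the `(n+1)`-st hidden
layer of some network with widths `p` and parameters bounded by one. -/
def ComputedAt (p : ℕ → ℕ) (X : Set (Fin (p 0) → ℝ)) (n : ℕ) {ι : Type}
    (F : ι → (Fin (p 0) → ℝ) → ℝ) : Prop :=
  ∃ (W : ∀ i, Matrix (Fin (p (i + 1))) (Fin (p i)) ℝ) (v : ∀ i, Fin (p i) → ℝ),
    (∀ i j k, |W i j k| ≤ 1) ∧ (∀ i j, |v i j| ≤ 1) ∧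
    ∃ e : ι → Fin (p (n + 1)), Function.Injective e ∧
      ∀ x ∈ X, ∀ i, shiftAct (v (n + 1)) (netLayers p W v x n) (e i) = F i x

lemma ComputedAt.reindex {p : ℕ → ℕ} {X : Set (Fin (p 0) → ℝ)} {n : ℕ} {ι κ : Type}
    {F : ι → (Fin (p 0) → ℝ) → ℝ} (h : ComputedAt p X n F) {s : κ → ι}
    (hs : Function.Injective s) : ComputedAt p X n (fun k => F (s k)) := by
  obtain ⟨W, v, hW, hv, e, he, hF⟩ := h
  exact ⟨W, v, hW, hv, e ∘ s, he.comp hs, fun x hx k => hF x hx (s k)⟩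

lemma abs_extend_le_one {ι κ : Type} (e : ι → κ) (f : ι → ℝ) (hf : ∀ i, |f i| ≤ 1) (k : κ) :
    |Function.extend e f 0 k| ≤ 1 := by
  classical
  rw [Function.extend_def]
  split_ifs
  · exact hf _
  · simp

lemma abs_extend_extend_le_one {ι κ ι' κ' : Type} (e : ι → κ) (e' : ι' → κ')
    (A : ι' → ι → ℝ) (hA : ∀ i j, |A i j| ≤ 1) (k' : κ') (k : κ) :
    |Function.extend e' (fun i' => Function.extend e (A i') 0) 0 k' k| ≤ 1 := by
  classical
  rw [Function.extend_def]
  split_ifs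
  · exact abs_extend_le_one e _ (hA _) k
  · simp

lemma sum_extend_mul {ι κ : Type} [Fintype ι] [Fintype κ] {e : ι → κ}
    (he : Function.Injective e) (a : ι → ℝ) (y : κ → ℝ) :
    ∑ k, Function.extend e a 0 k * y k = ∑ i, a i * y (e i) := by
  symm
  refine Fintype.sum_of_injective e he _ _ (fun k hk => ?_) (fun i => ?_)
  · rw [Function.extend_apply' _ _ _ (by simpa using hk)]
    simp
  · rw [he.extend_apply]

lemma abs_update_apply_le_one {p q : ℕ → ℕ} (W : ∀ i, Matrix (Fin (p i)) (Fin (q i)) ℝ)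
    (hW : ∀ i j k, |W i j k| ≤ 1) (n : ℕ) (M : Matrix (Fin (p n)) (Fin (q n)) ℝ)
    (hM : ∀ j k, |M j k| ≤ 1) (i : ℕ) (j : Fin (p i)) (k : Fin (q i)) :
    |Function.update W n M i j k| ≤ 1 := by
  rcases eq_or_ne i n with rfl | h
  · simpa using hM j k
  · simpa [Function.update_of_ne h] using hW i j k

lemma abs_update_le_one {p : ℕ → ℕ} (v : ∀ i, Fin (p i) → ℝ)
    (hv : ∀ i j, |v i j| ≤ 1) (n : ℕ) (w : Fin (p n) → ℝ)
    (hw : ∀ j, |w j| ≤ 1) (i : ℕ) (j : Fin (p i)) :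
    |Function.update v n w i j| ≤ 1 := by
  rcases eq_or_ne i n with rfl | h
  · simpa using hw j
  · simpa [Function.update_of_ne h] using hv i j

lemma exists_injective_fin {κ : Type} [Fintype κ] {N : ℕ} (h : Fintype.card κ ≤ N) :
    ∃ e : κ → Fin N, Function.Injective e := by
  obtain ⟨e⟩ := Function.Embedding.nonempty_of_card_le (α := κ) (β := Fin N) (by simpa using h)
  exact ⟨e, e.injective⟩

lemma computedAt_zero {p : ℕ → ℕ} (X : Set (Fin (p 0) → ℝ)) {κ : Type} [Fintype κ]
    (hκ : Fintype.card κ ≤ p 1) (A : κ → Fin (p 0) → ℝ) (hA : ∀ k i, |A k i| ≤ 1)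
    (c : κ → ℝ) (hc : ∀ k, |c k| ≤ 1) :
    ComputedAt p X 0 (fun k x => relu (∑ i, A k i * x i - c k)) := by
  obtain ⟨e, he⟩ := exists_injective_fin hκ
  refine ⟨Function.update (fun _ => 0) 0 (Matrix.of (Function.extend e A 0)),
    Function.update (fun _ => 0) 1 (Function.extend e c 0),
    abs_update_apply_le_one _ (by simp) _ _ (fun j k => ?_),
    abs_update_le_one _ (by simp) _ _ (abs_extend_le_one e c hc), e, he, fun x _ k => ?_⟩
  · classical
    rw [Matrix.of_apply, Function.extend_def]
    split_ifs
    · exact hA _ _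
    · simp
  · simp [shiftAct, netLayers, Matrix.mulVec, dotProduct, he.extend_apply]

lemma ComputedAt.succ {p : ℕ → ℕ} {X : Set (Fin (p 0) → ℝ)} {n : ℕ} {ι κ : Type}
    [Fintype ι] [Fintype κ] {F : ι → (Fin (p 0) → ℝ) → ℝ} (h : ComputedAt p X n F)
    (hκ : Fintype.card κ ≤ p (n + 2)) (A : κ → ι → ℝ) (hA : ∀ k i, |A k i| ≤ 1)
    (c : κ → ℝ) (hc : ∀ k, |c k| ≤ 1) :
    ComputedAt p X (n + 1) (fun k x => relu (∑ i, A k i * F i x - c k)) := by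
  obtain ⟨W, v, hW, hv, e, he, hF⟩ := h
  obtain ⟨e', he'⟩ := exists_injective_fin hκ
  refine ⟨Function.update W (n + 1)
      (Matrix.of (Function.extend e' (fun k => Function.extend e (A k) 0) 0)),
    Function.update v (n + 2) (Function.extend e' c 0),
    abs_update_apply_le_one _ hW _ _ (abs_extend_extend_le_one e e' A hA),
    abs_update_le_one _ hv _ _ (abs_extend_le_one e' c hc), e', he', fun x hx k => ?_⟩
  simp only [shiftAct, netLayers, Matrix.mulVec, dotProduct, Function.update_self,
    Matrix.of_apply, he'.extend_apply]
  rw [sum_extend_mul he]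
  simp only [← hF x hx, shiftAct]
  rw [Function.update_of_ne (by omega), netLayers_congr (W' := W) (v' := v) x n
    (fun i hi => Function.update_of_ne (by omega) _ _)
    (fun i hi => Function.update_of_ne (by omega) _ _)]

lemma ComputedAt.exists_netClass {p : ℕ → ℕ} {X : Set (Fin (p 0) → ℝ)} {n : ℕ} {ι : Type}
    [Fintype ι] {F : ι → (Fin (p 0) → ℝ) → ℝ} (h : ComputedAt p X n F)
    (A : Fin (p (n + 2)) → ι → ℝ) (hA : ∀ k i, |A k i| ≤ 1) :
    ∃ g ∈ NetClass (n + 1) p, ∀ x ∈ X, ∀ j, g x j = ∑ i, A j i * F i x := by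
  obtain ⟨W, v, hW, hv, e, he, hF⟩ := h
  refine ⟨_, ⟨Function.update W (n + 1) (Matrix.of fun k => Function.extend e (A k) 0), v,
    abs_update_apply_le_one _ hW _ _ (fun j => abs_extend_le_one e _ (hA j)), hv, rfl⟩,
    fun x hx j => ?_⟩
  simp only [networkFun, netLayers, Matrix.mulVec, dotProduct, Function.update_self,
    Matrix.of_apply]
  rw [sum_extend_mul he]
  simp only [← hF x hx]
  rw [netLayers_congr (W' := W) (v' := v) x n
    (fun i hi => Function.update_of_ne (by omega) _ _) (fun i hi => rfl)]

/-- Adding a layer that applies the same affine map to each block of neurons. -/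
lemma ComputedAt.succ_block {p : ℕ → ℕ} {X : Set (Fin (p 0) → ℝ)} {n : ℕ} {B S T : Type}
    [Fintype B] [Fintype S] [Fintype T] {F : B × S → (Fin (p 0) → ℝ) → ℝ}
    (h : ComputedAt p X n F) (hT : Fintype.card B * Fintype.card T ≤ p (n + 2))
    (C : T → S → ℝ) (hC : ∀ t s, |C t s| ≤ 1) (c : T → ℝ) (hc : ∀ t, |c t| ≤ 1)
    {G : B × T → (Fin (p 0) → ℝ) → ℝ}
    (hG : ∀ x ∈ X, ∀ b t, G (b, t) x = relu (∑ s, C t s * F (b, s) x - c t)) :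
    ComputedAt p X (n + 1) G := by
  classical
  have key := h.succ (κ := B × T) (by simpa using hT)
    (fun k i => if k.1 = i.1 then C k.2 i.2 else 0)
    (fun k i => by split_ifs <;> simp [hC]) (fun k => c k.2) (fun k => hc k.2)
  obtain ⟨W, v, hW, hv, e, he, hF⟩ := key
  refine ⟨W, v, hW, hv, e, he, fun x hx ⟨b, t⟩ => ?_⟩
  rw [hF x hx, hG x hx]
  beta_reduce
  rw [Fintype.sum_prod_type, Finset.sum_eq_single b]
  · simp
  · intro b' _ hb'
    simp [hb'.symm]
  · simp

/-! ## Approximate squaring -/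

/-- The rescaled iterated tent map `z ↦ T^k(z) / 4^k`. -/
def tooth : ℕ → ℝ → ℝ
  | 0, z => z
  | k + 1, z => relu (tooth k z / 2) - relu (tooth k z - 2 / 4 ^ (k + 1))

/-- The approximation `z - ∑_{1 ≤ i ≤ k} T^i(z) / 4^i` of `z²`. -/
def sqApprox : ℕ → ℝ → ℝ
  | 0, z => z
  | k + 1, z => sqApprox k z - tooth (k + 1) z

lemma tooth_bounds {z : ℝ} (h0 : 0 ≤ z) (h1 : z ≤ 1) (k : ℕ) :
    0 ≤ tooth k z ∧ 4 ^ k * tooth k z ≤ 1 ∧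
      sqApprox k z - z ^ 2 = tooth k z - 4 ^ k * tooth k z ^ 2 ∧ sqApprox k z ≤ z := by
  induction k with
  | zero => simp [tooth, sqApprox, h0, h1]
  | succ k ih =>
    obtain ⟨ht0, ht1, hsq, hle⟩ := ih
    simp only [tooth, sqApprox]
    set t := tooth k z
    have hQ : (0 : ℝ) < 4 ^ k := by positivity
    obtain ⟨c, hc, hQc⟩ : ∃ c : ℝ, (2 : ℝ) / 4 ^ (k + 1) = c ∧ 4 ^ k * c = 1 / 2 :=
      ⟨_, rfl, by rw [pow_succ]; field_simp; norm_num⟩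
    rw [hc, pow_succ]
    set Q : ℝ := 4 ^ k
    have hr1 : relu (t / 2) = t / 2 := max_eq_left (by linarith)
    rw [hr1]
    rcases le_total t c with h | h
    · have hr2 : relu (t - c) = 0 := max_eq_right (by linarith)
      rw [hr2]
      refine ⟨by linarith, ?_, ?_, by linarith⟩
      · nlinarith
      · linear_combination hsq
    · have hr2 : relu (t - c) = t - c := max_eq_left (by linarith)
      rw [hr2]
      have : t ≤ 2 * c := by
        by_contra! hcon
        nlinarith
      refine ⟨by linarith, ?_, ?_, by linarith⟩
      · nlinarith
      · linear_combination hsq + (4 * c - 4 * t) * hQc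

lemma sqApprox_bounds {z : ℝ} (h0 : 0 ≤ z) (h1 : z ≤ 1) (k : ℕ) :
    z ^ 2 ≤ sqApprox k z ∧ sqApprox k z ≤ z ^ 2 + (4 ^ k)⁻¹ ∧ sqApprox k z ≤ z := by
  obtain ⟨ht0, ht1, hsq, hle⟩ := tooth_bounds h0 h1 k
  have hQ : (0 : ℝ) < 4 ^ k := by positivity
  refine ⟨by nlinarith, ?_, hle⟩
  have : tooth k z ≤ (4 ^ k)⁻¹ := by
    rw [← one_div, le_div_iff₀ hQ]
    linarith
  nlinarith [mul_nonneg hQ.le (sq_nonneg (tooth k z))]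

/-- The approximation of `a * b` obtained by polarization from `sqApprox`. -/
def mulApprox (k : ℕ) (a b : ℝ) : ℝ :=
  relu (sqApprox k ((a + b) / 2) - sqApprox k (relu ((a - b) / 2) + relu ((b - a) / 2)))

lemma relu_add_relu_eq_abs (a b : ℝ) :
    relu ((a - b) / 2) + relu ((b - a) / 2) = |a - b| / 2 := by
  rcases le_total a b with h | h
  · rw [abs_of_nonpos (by linarith), relu, relu, max_eq_right (by linarith),
      max_eq_left (by linarith)]
    ring
  · rw [abs_of_nonneg (by linarith), relu, relu, max_eq_left (by linarith),
      max_eq_right (by linarith)]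
    ring

lemma mulApprox_bounds {a b : ℝ} (ha : a ∈ Set.Icc (0 : ℝ) 1) (hb : b ∈ Set.Icc (0 : ℝ) 1)
    (k : ℕ) : mulApprox k a b ∈ Set.Icc (0 : ℝ) 1 ∧ |mulApprox k a b - a * b| ≤ (4 ^ k)⁻¹ := by
  obtain ⟨ha0, ha1⟩ := ha
  obtain ⟨hb0, hb1⟩ := hb
  have hd : |a - b| ≤ 1 := abs_le.2 ⟨by linarith, by linarith⟩
  rw [mulApprox, relu_add_relu_eq_abs]
  obtain ⟨hs0, hs1, hs2⟩ := sqApprox_bounds (z := (a + b) / 2) (by linarith) (by linarith) k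
  obtain ⟨hd0, hd1, hd2⟩ := sqApprox_bounds (z := |a - b| / 2) (by positivity) (by linarith) k
  rw [div_pow, sq_abs] at hd0 hd1
  have hab : 0 ≤ a * b := mul_nonneg ha0 hb0
  have hsq : 0 ≤ (a - b) ^ 2 := sq_nonneg _
  have hQ : (0 : ℝ) < (4 ^ k)⁻¹ := by positivity
  refine ⟨⟨le_max_right _ _, max_le (by linarith) zero_le_one⟩, abs_le.2 ⟨?_, ?_⟩⟩
  · have := le_max_left (sqApprox k ((a + b) / 2) - sqApprox k (|a - b| / 2)) 0
    rw [relu]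
    linarith
  · rw [relu, sub_le_iff_le_add]
    exact max_le (by linarith) (by linarith)

/-! ## Multiplication networks -/

/-- The values of the six neurons carrying `k` steps of the squaring of `s` and of `d`. -/
def squareState (k : ℕ) (s d : ℝ) : Fin 6 → ℝ :=
  ![relu (tooth k s / 2), relu (tooth k s - 2 / 4 ^ (k + 1)), sqApprox k s,
    relu (tooth k d / 2), relu (tooth k d - 2 / 4 ^ (k + 1)), sqApprox k d]

lemma two_div_four_pow_le_one (k : ℕ) : |(2 : ℝ) / 4 ^ (k + 1)| ≤ 1 := by
  rw [abs_of_pos (by positivity), div_le_one (by positivity), pow_succ]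
  linarith [one_le_pow₀ (M₀ := ℝ) (a := 4) (by norm_num) (n := k)]

lemma relu_sqApprox {z : ℝ} (h0 : 0 ≤ z) (h1 : z ≤ 1) (k : ℕ) :
    relu (sqApprox k z) = sqApprox k z :=
  max_eq_left ((sq_nonneg z).trans (sqApprox_bounds h0 h1 k).1)

lemma ComputedAt.squareState_add {p : ℕ → ℕ} {X : Set (Fin (p 0) → ℝ)} {n : ℕ} {B : Type}
    [Fintype B] {s d : B → (Fin (p 0) → ℝ) → ℝ}
    (hs : ∀ x ∈ X, ∀ b, s b x ∈ Set.Icc (0 : ℝ) 1)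
    (hd : ∀ x ∈ X, ∀ b, d b x ∈ Set.Icc (0 : ℝ) 1)
    (h : ComputedAt p X n (fun (i : B × Fin 6) x => squareState 0 (s i.1 x) (d i.1 x) i.2))
    (k : ℕ) (hp : ∀ i, n + 1 < i → i ≤ n + k + 1 → 6 * Fintype.card B ≤ p i) :
    ComputedAt p X (n + k)
      (fun (i : B × Fin 6) x => squareState k (s i.1 x) (d i.1 x) i.2) := by
  induction k with
  | zero => exact h
  | succ k ih =>
    refine (ih fun i h1 h2 => hp i h1 (by omega)).succ_block
      (by have := hp (n + k + 2) (by omega) (by omega); simpa [mul_comm] using this)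
      !![1/2, -(1/2), 0, 0, 0, 0; 1, -1, 0, 0, 0, 0; -1, 1, 1, 0, 0, 0;
        0, 0, 0, 1/2, -(1/2), 0; 0, 0, 0, 1, -1, 0; 0, 0, 0, -1, 1, 1] ?_
      ![0, 2 / 4 ^ (k + 2), 0, 0, 2 / 4 ^ (k + 2), 0] ?_ ?_
    · intro t u
      fin_cases t <;> fin_cases u <;> norm_num [abs_le]
    · intro t
      have := two_div_four_pow_le_one (k + 1)
      fin_cases t <;> simp <;> exact this
    · intro x hx b t
      have e1 := relu_sqApprox (hs x hx b).1 (hs x hx b).2 (k + 1)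
      have e2 := relu_sqApprox (hd x hx b).1 (hd x hx b).2 (k + 1)
      fin_cases t
      · simp [squareState, Fin.sum_univ_succ, tooth]
        ring_nf
      · simp [squareState, Fin.sum_univ_succ, tooth]
        ring_nf
      · simp [squareState, Fin.sum_univ_succ]
        rw [← e1]
        simp only [sqApprox, tooth]
        ring_nf
      · simp [squareState, Fin.sum_univ_succ, tooth]
        ring_nf
      · simp [squareState, Fin.sum_univ_succ, tooth]
        ring_nf
      · simp [squareState, Fin.sum_univ_succ]
        rw [← e2]
        simp only [sqApprox, tooth]
        ring_nf

/-- Multiplying pairs of neurons approximately, using `k + 3` layers. -/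
lemma ComputedAt.mul {p : ℕ → ℕ} {X : Set (Fin (p 0) → ℝ)} {n : ℕ} {B : Type}
    [Fintype B] {F : B × Bool → (Fin (p 0) → ℝ) → ℝ} (h : ComputedAt p X n F)
    (hF : ∀ x ∈ X, ∀ i, F i x ∈ Set.Icc (0 : ℝ) 1) (k : ℕ)
    (hp : ∀ i, n + 1 < i → i ≤ n + (k + 3) + 1 → 6 * Fintype.card B ≤ p i) :
    ComputedAt p X (n + (k + 3))
      (fun b x => mulApprox (k + 1) (F (b, false) x) (F (b, true) x)) := by
  set s : B → (Fin (p 0) → ℝ) → ℝ := fun b x => (F (b, false) x + F (b, true) x) / 2 with hs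
  set d₁ : B → (Fin (p 0) → ℝ) → ℝ :=
    fun b x => relu ((F (b, false) x - F (b, true) x) / 2) with hd₁
  set d₂ : B → (Fin (p 0) → ℝ) → ℝ :=
    fun b x => relu ((F (b, true) x - F (b, false) x) / 2) with hd₂
  have hsI : ∀ x ∈ X, ∀ b, s b x ∈ Set.Icc (0 : ℝ) 1 := fun x hx b => by
    obtain ⟨h1, h2⟩ := hF x hx (b, false)
    obtain ⟨h3, h4⟩ := hF x hx (b, true)
    constructor <;> simp only [hs] <;> linarith
  have hdI : ∀ x ∈ X, ∀ b, d₁ b x + d₂ b x ∈ Set.Icc (0 : ℝ) 1 := fun x hx b => by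
    obtain ⟨h1, h2⟩ := hF x hx (b, false)
    obtain ⟨h3, h4⟩ := hF x hx (b, true)
    simp only [hd₁, hd₂, relu_add_relu_eq_abs]
    have : |F (b, false) x - F (b, true) x| ≤ 1 := abs_le.2 ⟨by linarith, by linarith⟩
    exact ⟨by positivity, by linarith⟩
  have l1 : ComputedAt p X (n + 1)
      (fun (i : B × Fin 3) x => ![s i.1 x, d₁ i.1 x, d₂ i.1 x] i.2) := by
    refine h.succ_block
      (by have := hp (n + 2) (by omega) (by omega); simp; omega)
      (fun t u => bif u then ![1/2, -(1/2), 1/2] t else ![1/2, 1/2, -(1/2)] t) ?_ 0 (by simp) ?_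
    · intro t u
      fin_cases t <;> fin_cases u <;> norm_num [abs_le]
    · intro x hx b t
      have e : relu (s b x) = s b x := max_eq_left (hsI x hx b).1
      fin_cases t
      · simp
        rw [← e]
        simp only [hs]
        ring_nf
      · simp [hd₁]
        ring_nf
      · simp [hd₂]
        ring_nf
  have l2 : ComputedAt p X (n + 2)
      (fun (i : B × Fin 6) x => squareState 0 (s i.1 x) (d₁ i.1 x + d₂ i.1 x) i.2) := by
    refine l1.succ_block
      (by have := hp (n + 3) (by omega) (by omega); simpa [mul_comm] using this)
      !![1/2, 0, 0; 1, 0, 0; 1, 0, 0; 0, 1/2, 1/2; 0, 1, 1; 0, 1, 1] ?_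
      ![0, 1/2, 0, 0, 1/2, 0] ?_ ?_
    · intro t u
      fin_cases t <;> fin_cases u <;> norm_num [abs_le]
    · intro t
      fin_cases t <;> norm_num [abs_le]
    · intro x hx b t
      have e1 : relu (s b x) = s b x := max_eq_left (hsI x hx b).1
      have e2 : relu (d₁ b x + d₂ b x) = d₁ b x + d₂ b x := max_eq_left (hdI x hx b).1
      fin_cases t <;>
        norm_num [squareState, Fin.sum_univ_succ, tooth, sqApprox, e1, e2] <;> ring_nf
  have l3 := l2.squareState_add hsI hdI k
    (fun i h1 h2 => hp i (by omega) (by omega))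
  have l4 : ComputedAt p X (n + 2 + k + 1) (fun (i : B × Unit) x =>
      mulApprox (k + 1) (F (i.1, false) x) (F (i.1, true) x)) := by
    refine l3.succ_block
      (by have := hp (n + k + 4) (by omega) (by omega)
          rw [show n + 2 + k + 2 = n + k + 4 by omega]; simp; omega)
      (fun _ => ![-1, 1, 1, 1, -1, -1]) ?_ 0 (by simp) ?_
    · intro t u
      fin_cases u <;> norm_num [abs_le]
    · intro x hx b t
      simp [Fin.sum_univ_succ, squareState, mulApprox, sqApprox]
      simp only [tooth, hs, hd₁, hd₂]
      ring_nf
  rw [show n + (k + 3) = n + 2 + k + 1 by omega]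
  exact l4.reindex (s := fun b => (b, ())) (fun a b hab => by simpa using hab)

lemma abs_prod_sub_prod_le_sum {ι : Type} (s : Finset ι) (f g : ι → ℝ)
    (hf : ∀ i ∈ s, |f i| ≤ 1) (hg : ∀ i ∈ s, |g i| ≤ 1) :
    |∏ i ∈ s, f i - ∏ i ∈ s, g i| ≤ ∑ i ∈ s, |f i - g i| := by
  classical
  induction s using Finset.induction_on with
  | empty => simp
  | insert a s ha ih =>
    rw [Finset.prod_insert ha, Finset.prod_insert ha, Finset.sum_insert ha]
    have ih' := ih (fun i hi => hf i (Finset.mem_insert_of_mem hi))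
      (fun i hi => hg i (Finset.mem_insert_of_mem hi))
    have hfa := hf a (Finset.mem_insert_self _ _)
    have hgs : |∏ i ∈ s, g i| ≤ 1 := by
      rw [Finset.abs_prod]
      exact Finset.prod_le_one (fun i _ => abs_nonneg _)
        (fun i hi => hg i (Finset.mem_insert_of_mem hi))
    calc |f a * ∏ i ∈ s, f i - g a * ∏ i ∈ s, g i|
        = |f a * (∏ i ∈ s, f i - ∏ i ∈ s, g i) + (f a - g a) * ∏ i ∈ s, g i| := by ring_nf
      _ ≤ |f a| * |∏ i ∈ s, f i - ∏ i ∈ s, g i| + |f a - g a| * |∏ i ∈ s, g i| := by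
          rw [← abs_mul, ← abs_mul]
          exact abs_add_le _ _
      _ ≤ 1 * |∏ i ∈ s, f i - ∏ i ∈ s, g i| + |f a - g a| * 1 := by gcongr
      _ ≤ |f a - g a| + ∑ i ∈ s, |f i - g i| := by linarith

/-- Multiplying families of `2 ^ K` neurons along a binary tree. -/
lemma ComputedAt.prod {p : ℕ → ℕ} {X : Set (Fin (p 0) → ℝ)} {A : Type} [Fintype A] (k : ℕ)
    (K : ℕ) {n : ℕ} {F : A × Fin (2 ^ K) → (Fin (p 0) → ℝ) → ℝ} (h : ComputedAt p X n F)
    (hF : ∀ x ∈ X, ∀ i, F i x ∈ Set.Icc (0 : ℝ) 1)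
    (hp : ∀ i, n + 1 < i → i ≤ n + (k + 3) * K + 1 → 3 * 2 ^ K * Fintype.card A ≤ p i) :
    ∃ G : A → (Fin (p 0) → ℝ) → ℝ, ComputedAt p X (n + (k + 3) * K) G ∧
      ∀ x ∈ X, ∀ a, G a x ∈ Set.Icc (0 : ℝ) 1 ∧
        |G a x - ∏ j, F (a, j) x| ≤ (2 ^ K - 1) * (4 ^ (k + 1))⁻¹ := by
  induction K generalizing n with
  | zero =>
    refine ⟨fun a => F (a, 0), ?_, fun x hx a => ⟨hF x hx _, ?_⟩⟩
    · simpa using h.reindex (s := fun a => (a, 0)) (fun a b hab => by simpa using hab)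
    · simp
  | succ K ih =>
    let σ : Fin (2 ^ K) × Bool ≃ Fin (2 ^ (K + 1)) :=
      Fintype.equivOfCardEq (by simp [pow_succ])
    have h1 : ComputedAt p X n (fun (i : (A × Fin (2 ^ K)) × Bool) =>
        F (i.1.1, σ (i.1.2, i.2))) :=
      h.reindex (s := fun i : (A × Fin (2 ^ K)) × Bool => (i.1.1, σ (i.1.2, i.2)))
        (fun ⟨⟨a, j⟩, c⟩ ⟨⟨a', j'⟩, c'⟩ hi => by simpa [and_assoc] using hi)
    have h2 := h1.mul (fun x hx i => hF x hx _) k (fun i hi1 hi2 => by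
      refine le_trans (le_of_eq ?_) (hp i hi1 (by rw [Nat.mul_succ]; omega))
      rw [Fintype.card_prod, Fintype.card_fin, pow_succ]
      ring)
    have hM : ∀ x ∈ X, ∀ (a : A) (j : Fin (2 ^ K)), _ := fun x hx a j =>
      mulApprox_bounds (hF x hx (a, σ (j, false))) (hF x hx (a, σ (j, true))) (k + 1)
    obtain ⟨G, hG, hG'⟩ := ih h2 (fun x hx i => (hM x hx i.1 i.2).1) (fun i hi1 hi2 => by
      refine le_trans ?_ (hp i (by omega) (by rw [Nat.mul_succ]; omega))
      gcongr <;> omega)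
    refine ⟨G, by rwa [Nat.mul_succ, add_comm _ (k + 3), ← add_assoc], fun x hx a =>
      ⟨(hG' x hx a).1, ?_⟩⟩
    have hprod : ∏ j, F (a, j) x = ∏ j, F (a, σ (j, false)) x * F (a, σ (j, true)) x := by
      rw [← σ.prod_comp, Fintype.prod_prod_type]
      exact Finset.prod_congr rfl fun j _ => by rw [Fintype.prod_bool, mul_comm]
    rw [hprod]
    have hI : ∀ i, |F (a, i) x| ≤ 1 := fun i => by
      obtain ⟨h0, h1⟩ := hF x hx (a, i)
      exact abs_le.2 ⟨by linarith, h1⟩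
    have hdiff := abs_prod_sub_prod_le_sum Finset.univ
      (fun j => mulApprox (k + 1) (F (a, σ (j, false)) x) (F (a, σ (j, true)) x))
      (fun j => F (a, σ (j, false)) x * F (a, σ (j, true)) x)
      (fun j _ => by
        obtain ⟨h0, h1⟩ := (hM x hx a j).1
        exact abs_le.2 ⟨by linarith, h1⟩)
      (fun j _ => by
        rw [abs_mul]
        exact mul_le_one₀ (hI _) (abs_nonneg _) (hI _))
    have hsum := Finset.sum_le_card_nsmul Finset.univ _ _ (fun j _ => (hM x hx a j).2)
    simp only [Finset.card_univ, Fintype.card_fin, nsmul_eq_mul, Nat.cast_pow,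
      Nat.cast_ofNat] at hsum
    have htri := abs_sub_le (G a x)
      (∏ j, mulApprox (k + 1) (F (a, σ (j, false)) x) (F (a, σ (j, true)) x))
      (∏ j, F (a, σ (j, false)) x * F (a, σ (j, true)) x)
    have hGa := (hG' x hx a).2
    linarith [show ((2 : ℝ) ^ (K + 1) - 1) * (4 ^ (k + 1))⁻¹ =
      (2 ^ K - 1) * (4 ^ (k + 1))⁻¹ + 2 ^ K * (4 ^ (k + 1))⁻¹ by ring]

/-! ## Monomials -/

/-- A monomial of degree at most `N` is a product of `N` factors, each a coordinate or one. -/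
lemma exists_factors {r N : ℕ} (α : Fin r → ℕ) (hα : ∑ i, α i ≤ N) :
    ∃ l : Fin N → Option (Fin r), ∀ x : Fin r → ℝ, ∏ j, (l j).elim 1 x = ∏ i, x i ^ α i := by
  obtain ⟨e, he⟩ := exists_injective_fin (κ := Σ i, Fin (α i)) (N := N) (by simpa using hα)
  refine ⟨Function.extend e (fun s => some s.1) (fun _ => none), fun x => ?_⟩
  rw [← Fintype.prod_of_injective e he (fun s => x s.1)]
  · simp [Fintype.prod_sigma]
  · intro j hj
    rw [Function.extend_apply' _ _ _ (by simpa using hj)]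
    rfl
  · intro s
    rw [he.extend_apply]
    rfl

lemma computedAt_zero_option {p : ℕ → ℕ} {κ : Type} [Fintype κ]
    (hκ : Fintype.card κ ≤ p 1) (l : κ → Option (Fin (p 0))) :
    ComputedAt p (unitCube (p 0)) 0 (fun k x => (l k).elim 1 x) := by
  classical
  obtain ⟨W, v, hW, hv, e, he, hF⟩ := computedAt_zero (unitCube (p 0)) hκ
    (fun k i => if l k = some i then 1 else 0) (fun k i => by split_ifs <;> simp)
    (fun k => if l k = none then -1 else 0) (fun k => by split_ifs <;> simp)
  refine ⟨W, v, hW, hv, e, he, fun x hx k => ?_⟩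
  rw [hF x hx]
  rcases hk : l k with _ | i
  · simp [hk, relu]
  · simpa [hk, relu] using (hx i).1

lemma two_pow_ceil_logb_bounds {γ : ℝ} (hγ : 0 < γ) :
    γ ≤ 2 ^ (⌈Real.logb 2 (max γ 1)⌉).toNat ∧
      (2 : ℝ) ^ (⌈Real.logb 2 (max γ 1)⌉).toNat - 1 ≤ γ ^ 2 ∧
      2 ^ (⌈Real.logb 2 (max γ 1)⌉).toNat ≤ 2 * ⌈γ⌉₊ := by
  have hN : 1 ≤ ⌈γ⌉₊ := Nat.one_le_iff_ne_zero.2 (Nat.ceil_pos.2 hγ).ne'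
  rcases le_or_gt γ 1 with h | h
  · rw [max_eq_right h]
    simp
    exact ⟨h, sq_nonneg γ, by omega⟩
  · rw [max_eq_left h.le]
    have hlog : 0 < Real.logb 2 γ := Real.logb_pos (by norm_num) h
    set K := (⌈Real.logb 2 γ⌉).toNat with hK
    have hKc : ((K : ℤ) : ℝ) = (⌈Real.logb 2 γ⌉ : ℝ) := by
      rw [hK, Int.toNat_of_nonneg (Int.ceil_nonneg hlog.le)]
    rw [Int.cast_natCast] at hKc
    have h1 : γ ≤ 2 ^ K := by
      rw [← Real.rpow_natCast, ← Real.logb_le_iff_le_rpow (by norm_num) hγ, hKc]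
      exact Int.le_ceil _
    have h2 : (2 : ℝ) ^ K < 2 * γ := by
      have := Int.ceil_lt_add_one (Real.logb 2 γ)
      rw [← hKc] at this
      rw [← Real.rpow_natCast, ← Real.lt_logb_iff_rpow_lt (by norm_num) (by positivity),
        Real.logb_mul (by norm_num) hγ.ne', Real.logb_self_eq_one (by norm_num)]
      linarith
    refine ⟨h1, by nlinarith [sq_nonneg (γ - 1)], ?_⟩
    have : (2 : ℝ) ^ K ≤ 2 * (⌈γ⌉₊ : ℝ) := by linarith [Nat.le_ceil γ]
    exact_mod_cast this

lemma zero_mem_multiIndicesLt (r : ℕ) {γ : ℝ} (hγ : 0 < γ) : 0 ∈ multiIndicesLt r γ := by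
  simp [multiIndicesLt, hγ]

/-- Lemma A.4: ReLU network simultaneously approximating all
monomials `x^α` with `|α| < γ`; the output coordinates are indexed through the
injection `ind` of the multi-indices. -/
theorem statement15 (r m : ℕ) (γ : ℝ) (hr : 1 ≤ r) (hm : 1 ≤ m) (hγ : 0 < γ)
    (L : ℕ) (hL : L = 1 + (m + 5) * (⌈Real.logb 2 (max γ 1)⌉).toNat)
    (p : ℕ → ℕ) (hp0 : p 0 = r) (hpL : p (L + 1) = (multiIndicesLt r γ).card)
    (hpmid : ∀ i, 1 ≤ i → i ≤ L → p i = 6 * ⌈γ⌉₊ * (multiIndicesLt r γ).card) :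
    ∃ g ∈ NetClass L p, ∃ h0 : p 0 = r,
    ∃ ind : (Fin r → ℕ) → Fin (p (L + 1)),
      Set.InjOn ind (multiIndicesLt r γ) ∧
      ∀ x ∈ unitCube r,
        (∀ j, g (fun k => x (Fin.cast h0 k)) j ∈ Set.Icc (0 : ℝ) 1) ∧
        ∀ α ∈ multiIndicesLt r γ,
          |g (fun k => x (Fin.cast h0 k)) (ind α) - ∏ i, x i ^ α i| ≤
            γ ^ 2 * ((2 : ℝ) ^ m)⁻¹ := by
  subst hp0
  obtain ⟨hK1, hK2, hK3⟩ := two_pow_ceil_logb_bounds hγ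
  set K := (⌈Real.logb 2 (max γ 1)⌉).toNat
  set S := multiIndicesLt (p 0) γ
  have hwidth : 3 * 2 ^ K * Fintype.card S ≤ 6 * ⌈γ⌉₊ * S.card := by
    rw [Fintype.card_coe]
    exact Nat.mul_le_mul_right _ (by omega)
  have hdeg : ∀ α : S, ∑ i, α.1 i ≤ 2 ^ K := fun α => by
    have h1 := (Finset.mem_filter.1 α.2).2
    have h2 := h1.le.trans hK1
    exact_mod_cast h2
  choose l hl using fun α : S => exists_factors α.1 (hdeg α)
  have hleaf : ComputedAt p (unitCube (p 0)) 0
      (fun (i : S × Fin (2 ^ K)) x => (l i.1 i.2).elim 1 x) := by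
    refine computedAt_zero_option ?_ (fun i : S × Fin (2 ^ K) => l i.1 i.2)
    rw [hpmid 1 le_rfl (by omega)]
    refine le_trans ?_ hwidth
    rw [Fintype.card_prod, Fintype.card_fin, mul_comm]
    gcongr
    omega
  obtain ⟨G, hG, hG'⟩ := hleaf.prod (m + 2) K
    (fun x hx i => by
      rcases l i.1 i.2 with _ | j
      · simp
      · exact hx j)
    (fun i h1 h2 => by
      rw [hpmid i (by omega) (by rw [hL]; change i ≤ 0 + (m + 5) * K + 1 at h2; omega)]
      exact hwidth)
  rw [zero_add] at hG
  obtain rfl : L = (m + 5) * K + 1 := by omega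
  let e : S ≃ Fin (p ((m + 5) * K + 1 + 1)) := Fintype.equivOfCardEq (by simp [hpL])
  classical
  obtain ⟨g, hg, hgG⟩ := hG.exists_netClass (fun j i => if e.symm j = i then 1 else 0)
    (fun j i => by split_ifs <;> simp)
  have hgG' : ∀ x ∈ unitCube (p 0), ∀ j, g x j = G (e.symm j) x := fun x hx j => by
    rw [hgG x hx]
    simp
  refine ⟨g, hg, rfl, fun α => if h : α ∈ S then e ⟨α, h⟩ else
    e ⟨0, zero_mem_multiIndicesLt _ hγ⟩, ?_, fun x hx => ⟨fun j => ?_, fun α hα => ?_⟩⟩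
  · intro α hα β hβ hαβ
    have hα' : α ∈ S := hα
    have hβ' : β ∈ S := hβ
    simpa [hα', hβ'] using hαβ
  · exact (hgG' x hx j).symm ▸ (hG' x hx _).1
  · have h1 := (hG' x hx ⟨α, hα⟩).2
    rw [hl ⟨α, hα⟩ x] at h1
    have h2 : ((4 : ℝ) ^ (m + 2 + 1))⁻¹ ≤ (2 ^ m)⁻¹ := by
      refine inv_anti₀ (by positivity) ?_
      calc (2 : ℝ) ^ m ≤ 4 ^ m := by gcongr; norm_num
        _ ≤ 4 ^ (m + 2 + 1) := pow_le_pow_right₀ (by norm_num) (by omega)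
    change |g x _ - _| ≤ _
    rw [hgG' x hx]
    beta_reduce
    rw [dif_pos hα, Equiv.symm_apply_apply]
    refine h1.trans ?_
    gcongr

end
end
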